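/- arXiv:1610.03999 — 2 statements merged into one kernel-verified Lean document; each statement's English description precedes it below -/
import Mathlib

section
/- Every K_4-minor-free graph of odd-girth at least 2k+1 admits a homomorphism to the projective hypercube PC(2k). -/
open SimpleGraph

/-- The projective hypercube `PC(2k)`: the Cayley graph on `ℤ₂^{2k}` with connection
set consisting of the `2k` standard basis vectors and the all-ones vector. -/
def PC (k : ℕ) : SimpleGraph (Fin (2*k) → ZMod 2) :=
  SimpleGraph.fromRel fun x y =>
    (∃ i : Fin (2*k), y = x + fun j => if j = i then 1 else 0) ∨
    y = x + fun _ => 1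

/-- `G` has odd-girth at least `n`: every odd cycle has length at least `n`. -/
def oddGirthAtLeast {V : Type*} (G : SimpleGraph V) (n : ℕ) : Prop :=
  ∀ (x : V) (w : G.Walk x x), w.IsCycle → Odd w.length → n ≤ w.length

/-- `G` has a `K₄` minor: there are four nonempty, pairwise disjoint, connected
branch sets with an edge of `G` between every two of them. -/
def HasK4Minor {V : Type*} (G : SimpleGraph V) : Prop :=
  ∃ S : Fin 4 → Set V,
    (∀ i, (S i).Nonempty) ∧
    (∀ i, (G.induce (S i)).Connected) ∧
    (Pairwise fun i j => Disjoint (S i) (S j)) ∧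
    (Pairwise fun i j => ∃ a ∈ S i, ∃ b ∈ S j, G.Adj a b)

section OddWalks

variable {V : Type*} {G : SimpleGraph V}

lemma exists_closed_subwalk_of_not_isPath {u v : V} (p : G.Walk u v) (hp : ¬ p.IsPath) :
    ∃ (x : V) (q₁ : G.Walk u x) (c : G.Walk x x) (q₂ : G.Walk x v),
      0 < c.length ∧ p.length = q₁.length + c.length + q₂.length := by
  classical
  induction p with
  | nil => exact absurd Walk.IsPath.nil hp
  | @cons u w v h p ih =>
    by_cases hpp : p.IsPath
    · have hu : u ∈ p.support := by
        by_contra hu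
        exact hp ((Walk.cons_isPath_iff h p).2 ⟨hpp, hu⟩)
      refine ⟨u, .nil, .cons h (p.takeUntil u hu), p.dropUntil u hu, by simp, ?_⟩
      have := congrArg Walk.length (p.take_spec hu)
      rw [Walk.length_append] at this
      simp only [Walk.length_cons, Walk.length_nil]
      omega
    · obtain ⟨x, q₁, c, q₂, hc, hl⟩ := ih hpp
      refine ⟨x, .cons h q₁, c, q₂, hc, ?_⟩
      simp only [Walk.length_cons]
      omega

lemma isCycle_cons_of_even_path {u v : V} (h : G.Adj u v) (p : G.Walk v u) (hp : p.IsPath)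
    (he : Even p.length) : (Walk.cons h p).IsCycle := by
  refine (Walk.cons_isCycle_iff p h).2 ⟨hp, fun hm => ?_⟩
  cases p with
  | nil => exact h.ne rfl
  | @cons _ x _ h' p =>
    rw [Walk.cons_isPath_iff] at hp
    rw [Walk.edges_cons, List.mem_cons] at hm
    rcases hm with hm | hm
    · have : u = x := by
        rcases Sym2.eq_iff.1 hm with ⟨rfl, _⟩ | ⟨rfl, _⟩
        · exact absurd rfl h.ne
        · rfl
      subst this
      rw [(Walk.isPath_iff_nil.1 hp.1).eq_nil] at he
      simp at he
    · exact hp.2 (p.snd_mem_support_of_mem_edges hm)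

lemma exists_odd_cycle_of_odd_closed_walk {u : V} (p : G.Walk u u) (hp : Odd p.length) :
    ∃ (x : V) (w : G.Walk x x), w.IsCycle ∧ Odd w.length ∧ w.length ≤ p.length := by
  induction hn : p.length using Nat.strong_induction_on generalizing u with
  | _ n ih =>
  subst hn
  cases p with
  | nil => simp at hp
  | @cons _ v _ h p =>
    have he : Even p.length := by
      rw [Walk.length_cons] at hp
      grind
    by_cases hpp : p.IsPath
    · exact ⟨u, _, isCycle_cons_of_even_path h p hpp he, hp, le_rfl⟩
    · obtain ⟨x, q₁, c, q₂, hc, hl⟩ := exists_closed_subwalk_of_not_isPath p hpp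
      rcases Nat.even_or_odd c.length with hce | hco
      · obtain ⟨y, w, hw, hwo, hwl⟩ := ih (Walk.cons h (q₁.append q₂)).length
          (by simp only [Walk.length_cons, Walk.length_append]; omega) (Walk.cons h (q₁.append q₂))
          (by simp only [Walk.length_cons, Walk.length_append]; grind) rfl
        refine ⟨y, w, hw, hwo, hwl.trans ?_⟩
        simp only [Walk.length_cons, Walk.length_append]; omega
      · obtain ⟨y, w, hw, hwo, hwl⟩ := ih c.length
          (by simp only [Walk.length_cons]; omega) c hco rfl
        refine ⟨y, w, hw, hwo, hwl.trans ?_⟩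
        simp only [Walk.length_cons]; omega

lemma oddGirthAtLeast.le_length {n : ℕ} (h : oddGirthAtLeast G n) {u : V} (p : G.Walk u u)
    (hp : Odd p.length) : n ≤ p.length := by
  obtain ⟨x, w, hw, hwo, hwl⟩ := exists_odd_cycle_of_odd_closed_walk p hp
  exact (h x w hw hwo).trans hwl

end OddWalks

section VirtualWalks

variable {V : Type*}

/-- `LengthWalk R u v n`: there is a walk from `u` to `v` of total length `n` whose steps
`(a, b)` of length `l` are those with `(a, b, l) ∈ R` or `(b, a, l) ∈ R`. -/
inductive LengthWalk (R : Set (V × V × ℕ)) : V → V → ℕ → Prop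
  | nil (u : V) : LengthWalk R u u 0
  | cons {u v w : V} {l n : ℕ} (h : (u, v, l) ∈ R ∨ (v, u, l) ∈ R) (p : LengthWalk R v w n) :
      LengthWalk R u w (l + n)

/-- All odd closed walks with steps in `R` have length at least `N`. -/
def OddClosedAtLeast (R : Set (V × V × ℕ)) (N : ℕ) : Prop :=
  ∀ u n, LengthWalk R u u n → Odd n → N ≤ n

namespace LengthWalk

variable {R : Set (V × V × ℕ)} {u v w : V} {m n l N : ℕ}

lemma single (h : (u, v, l) ∈ R ∨ (v, u, l) ∈ R) : LengthWalk R u v l :=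
  cons h (nil v)

lemma append (p : LengthWalk R u v m) (q : LengthWalk R v w n) : LengthWalk R u w (m + n) := by
  induction p with
  | nil => simpa using q
  | cons h _ ih => rw [add_assoc]; exact cons h (ih q)

lemma symm (p : LengthWalk R u v n) : LengthWalk R v u n := by
  induction p with
  | nil => exact nil _
  | cons h _ ih => rw [add_comm]; exact ih.append (single h.symm)

/-- After adding one new step, a short walk can be replaced by one of the same parity which uses
the new step at most once. -/
lemma reduce (hR : OddClosedAtLeast R N)
    (H : ∀ m, LengthWalk R v u m → Odd (l + m) → N ≤ l + m) {a b : V}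
    (p : LengthWalk (insert (u, v, l) R) a b n) :
    N ≤ n ∨ ∃ n' ≤ n, (Even n ↔ Even n') ∧ (LengthWalk R a b n' ∨
      ∃ i j, i + l + j = n' ∧ ((LengthWalk R a u i ∧ LengthWalk R v b j) ∨
        (LengthWalk R a v i ∧ LengthWalk R u b j))) := by
  have key : ∀ {a b x y : V} {n : ℕ}, (x = u ∧ y = v ∨ x = v ∧ y = u) →
      (LengthWalk R y b n ∨
      ∃ i j, i + l + j = n ∧ ((LengthWalk R y x i ∧ LengthWalk R y b j) ∨
        (LengthWalk R y y i ∧ LengthWalk R x b j))) →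
      N ≤ l + n ∨ ∃ n' ≤ l + n, (Even (l + n) ↔ Even n') ∧ (LengthWalk R x b n' ∨
        ∃ i j, i + l + j = n' ∧ LengthWalk R x x i ∧ LengthWalk R y b j) := by
    rintro a b x y n hxy (h | ⟨i, j, rfl, ⟨h₁, h₂⟩ | ⟨h₁, h₂⟩⟩)
    · exact .inr ⟨l + n, le_rfl, Iff.rfl, .inr ⟨0, n, by omega, nil _, h⟩⟩
    · rcases Nat.even_or_odd (l + i) with he | ho
      · exact .inr ⟨l + j, by omega, by grind, .inr ⟨0, j, by omega, nil _, h₂⟩⟩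
      · left
        have : N ≤ l + i := by
          rcases hxy with ⟨rfl, rfl⟩ | ⟨rfl, rfl⟩
          · exact H i h₁ ho
          · exact H i h₁.symm ho
        omega
    · rcases Nat.even_or_odd i with he | ho
      · exact .inr ⟨j, by omega, by grind, .inl h₂⟩
      · left
        have := hR _ _ h₁ ho
        omega
  induction p with
  | nil a => exact .inr ⟨0, le_rfl, Iff.rfl, .inl (nil a)⟩
  | @cons a c b s n h p ih =>
    rcases ih with ih | ⟨n', hn', hpar, ih⟩
    · exact .inl (by omega)
    by_cases hnew : (a = u ∧ c = v ∨ a = v ∧ c = u) ∧ s = l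
    · obtain ⟨hac, rfl⟩ := hnew
      have := key (a := a) (b := b) (x := a) (y := c) (n := n') hac (by
        rcases hac with ⟨rfl, rfl⟩ | ⟨rfl, rfl⟩
        · exact ih
        · rcases ih with ih | ⟨i, j, hij, ih⟩
          · exact .inl ih
          · exact .inr ⟨i, j, hij, ih.symm⟩)
      rcases this with h | ⟨m, hm, hme, h⟩
      · exact .inl (by omega)
      · refine .inr ⟨m, by omega, by grind, ?_⟩
        rcases h with h | ⟨i, j, hij, h₁, h₂⟩
        · exact .inl h
        · refine .inr ⟨i, j, hij, ?_⟩
          rcases hac with ⟨rfl, rfl⟩ | ⟨rfl, rfl⟩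
          · exact .inl ⟨h₁, h₂⟩
          · exact .inr ⟨h₁, h₂⟩
    · have hold : (a, c, s) ∈ R ∨ (c, a, s) ∈ R := by
        simp only [Set.mem_insert_iff, Prod.mk.injEq] at h
        grind
      refine .inr ⟨s + n', by omega, by grind, ?_⟩
      rcases ih with ih | ⟨i, j, hij, ih⟩
      · exact .inl (cons hold ih)
      · refine .inr ⟨s + i, j, by omega, ?_⟩
        exact ih.imp (fun h => ⟨cons hold h.1, h.2⟩) fun h => ⟨cons hold h.1, h.2⟩

end LengthWalk

lemma OddClosedAtLeast.insert {R : Set (V × V × ℕ)} {N l : ℕ} {u v : V}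
    (hR : OddClosedAtLeast R N) (H : ∀ m, LengthWalk R v u m → Odd (l + m) → N ≤ l + m) :
    OddClosedAtLeast (insert (u, v, l) R) N := by
  intro a n p ho
  rcases p.reduce hR H with h | ⟨n', hn', hpar, h | ⟨i, j, rfl, ⟨h₁, h₂⟩ | ⟨h₁, h₂⟩⟩⟩
  · exact h
  · exact (hR a n' h (by grind)).trans hn'
  · have := H _ (h₂.append h₁) (by grind)
    omega
  · have := H _ (h₁.symm.append h₂.symm) (by grind)
    omega

lemma exists_maximal_oddClosedAtLeast [Finite V] {R₀ : Set (V × V × ℕ)} {N : ℕ}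
    (hR₀ : OddClosedAtLeast R₀ N) :
    ∃ R, R₀ ⊆ R ∧ OddClosedAtLeast R N ∧ ∀ u v l, l ≤ N →
      (∀ m, LengthWalk R v u m → Odd (l + m) → N ≤ l + m) → LengthWalk R u v l := by
  let B : Set (V × V × ℕ) := Set.univ ×ˢ Set.univ ×ˢ Set.Iic N
  have hB : B.Finite := Set.finite_univ.prod (Set.finite_univ.prod (Set.finite_Iic N))
  let F : Set (Set (V × V × ℕ)) := {T | T ⊆ B ∧ OddClosedAtLeast (R₀ ∪ T) N}
  have hF : F.Finite := hB.finite_subsets.subset fun T hT => hT.1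
  obtain ⟨T, hT⟩ := hF.exists_maximal ⟨∅, Set.empty_subset _, by simpa using hR₀⟩
  refine ⟨R₀ ∪ T, Set.subset_union_left, hT.prop.2, fun u v l hl H => ?_⟩
  have hins : insert (u, v, l) T ∈ F := by
    refine ⟨Set.insert_subset (by simp [B, hl]) hT.prop.1, ?_⟩
    rw [Set.union_insert]
    exact hT.prop.2.insert H
  have := hT.le_of_ge hins (Set.subset_insert _ _) (Set.mem_insert _ _)
  exact .single (.inl (.inr this))

/-- In a graph of odd girth at least `2k+1`, the even distances can be shortened to an
even-valued semimetric which gives every edge the length `2k`, and for which all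
triangles have perimeter at most `2(2k+1)`. -/
lemma exists_even_semimetric [Finite V] (k : ℕ) (G : SimpleGraph V)
    (hG : oddGirthAtLeast G (2 * k + 1)) :
    ∃ d : V → V → ℕ, (∀ u v, Even (d u v)) ∧ (∀ u v, d u v = d v u) ∧
      (∀ u v, d u v ≤ 2 * k) ∧ (∀ u v w, d u w ≤ d u v + d v w) ∧
      (∀ u v w, d u v + d v w + d u w ≤ 2 * (2 * k + 1)) ∧
      ∀ u v, G.Adj u v → d u v = 2 * k := by
  classical
  have hR₀ : OddClosedAtLeast {t : V × V × ℕ | G.Adj t.1 t.2.1 ∧ t.2.2 = 1} (2 * k + 1) := by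
    intro u n p ho
    suffices ∀ {a b n}, LengthWalk {t : V × V × ℕ | G.Adj t.1 t.2.1 ∧ t.2.2 = 1} a b n →
        ∃ w : G.Walk a b, w.length = n by
      obtain ⟨w, rfl⟩ := this p
      exact hG.le_length w ho
    intro a b n p
    induction p with
    | nil => exact ⟨.nil, rfl⟩
    | cons h _ ih =>
      obtain ⟨w, rfl⟩ := ih
      rcases h with ⟨h, rfl⟩ | ⟨h, rfl⟩
      · exact ⟨.cons h w, by rw [Walk.length_cons, add_comm]⟩
      · exact ⟨.cons h.symm w, by rw [Walk.length_cons, add_comm]⟩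
  obtain ⟨R, hR₀R, hR, hmax⟩ := exists_maximal_oddClosedAtLeast hR₀
  have htight : ∀ u v, ∃ e, Even e ∧ e ≤ 2 * k ∧ LengthWalk R u v e ∧
      LengthWalk R u v (2 * k + 1 - e) := by
    intro u v
    have hex : ∃ e, Even e ∧ LengthWalk R u v e :=
      ⟨2 * k, by simp, hmax _ _ _ (by omega) fun m _ ho => by grind⟩
    have hle : Nat.find hex ≤ 2 * k :=
      Nat.find_min' hex ⟨by simp, hmax _ _ _ (by omega) fun m _ ho => by grind⟩
    obtain ⟨he, hw⟩ := Nat.find_spec hex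
    refine ⟨Nat.find hex, he, hle, hw, hmax _ _ _ (by omega) fun m hm ho => ?_⟩
    have := Nat.find_min' hex (m := m) ⟨by grind, hm.symm⟩
    omega
  choose d hde hdk hd hd' using htight
  have hmin : ∀ u v n, LengthWalk R u v n → Even n → d u v ≤ n := by
    intro u v n p hn
    have := hR _ _ (p.append (hd' u v).symm) (by grind)
    have := hdk u v
    omega
  refine ⟨d, hde, fun u v => le_antisymm (hmin _ _ _ (hd v u).symm (hde _ _))
    (hmin _ _ _ (hd u v).symm (hde _ _)), hdk,
    fun u v w => hmin _ _ _ ((hd u v).append (hd v w)) ((hde _ _).add (hde _ _)),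
    fun u v w => ?_, fun u v h => ?_⟩
  · have := hR _ _ (((hd' u v).append (hd' v w)).append (hd' u w).symm) (by grind)
    have := hdk u v
    have := hdk v w
    have := hdk u w
    omega
  · have := hR _ _ ((LengthWalk.single (.inl (hR₀R ⟨h, rfl⟩))).append (hd u v).symm) (by grind)
    have := hdk u v
    omega

end VirtualWalks

section Minors

variable {V : Type*} {G : SimpleGraph V}

/-- The preimage of a connected set under a map with connected fibres is connected. -/
lemma connected_induce_preimage {W : Type*} {H : SimpleGraph W} (φ : V → W)
    (hφ : Function.Surjective φ)
    (hfib : ∀ {x y}, φ x = φ y → x = y ∨ G.Adj x y)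
    (hadj : ∀ {a b}, H.Adj a b → ∃ x y, φ x = a ∧ φ y = b ∧ G.Adj x y)
    {S : Set W} (hS : (H.induce S).Connected) : (G.induce (φ ⁻¹' S)).Connected := by
  have fib : ∀ x y : φ ⁻¹' S, φ x = φ y → (G.induce (φ ⁻¹' S)).Reachable x y := by
    intro x y h
    rcases hfib h with h | h
    · rw [Subtype.ext h]
    · exact Adj.reachable (G := G.induce (φ ⁻¹' S)) h
  have walk : ∀ (a b : S), (H.induce S).Walk a b → ∀ x y : φ ⁻¹' S, φ x = a → φ y = b →
      (G.induce (φ ⁻¹' S)).Reachable x y := by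
    intro a b p
    induction p with
    | nil => exact fun x y hx hy => fib x y (hx.trans hy.symm)
    | @cons a c b h p ih =>
      intro x y hx hy
      obtain ⟨x', z, hx', hz, hxz⟩ := hadj h
      have h₁ := fib x ⟨x', by simp [hx']⟩ (hx.trans hx'.symm)
      have h₂ : (G.induce (φ ⁻¹' S)).Reachable ⟨x', by simp [hx']⟩ ⟨z, by simp [hz]⟩ :=
        Adj.reachable (G := G.induce (φ ⁻¹' S)) hxz
      exact (h₁.trans h₂).trans (ih ⟨z, by simp [hz]⟩ y hz hy)
  obtain ⟨a⟩ := hS.nonempty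
  obtain ⟨x, hx⟩ := hφ a
  have : Nonempty (φ ⁻¹' S) := ⟨⟨x, by simp [hx]⟩⟩
  refine Connected.mk fun x y => ?_
  obtain ⟨p⟩ := hS.preconnected ⟨φ x, x.2⟩ ⟨φ y, y.2⟩
  exact walk _ _ p x y rfl rfl

lemma HasK4Minor.of_induce {s : Set V} (h : HasK4Minor (G.induce s)) : HasK4Minor G := by
  obtain ⟨S, hne, hconn, hdisj, hadj⟩ := h
  refine ⟨fun i => Subtype.val '' S i, fun i => (hne i).image _, fun i => ?_,
    fun i j hij => (Set.disjoint_image_iff Subtype.val_injective).2 (hdisj hij), fun i j hij => ?_⟩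
  · refine (hconn i).map (⟨fun x => ⟨x.1.1, x.1, x.2, rfl⟩, fun h => h⟩ :
      (G.induce s).induce (S i) →g G.induce (Subtype.val '' S i)) ?_
    rintro ⟨_, x, hx, rfl⟩
    exact ⟨⟨x, hx⟩, rfl⟩
  · obtain ⟨a, ha, b, hb, hab⟩ := hadj hij
    exact ⟨a, ⟨a, ha, rfl⟩, b, ⟨b, hb, rfl⟩, hab⟩

/-- The graph obtained by identifying `u` with `v`. -/
def contractInto (G : SimpleGraph V) (u v : V) : SimpleGraph {w // w ≠ u} where
  Adj a b := a ≠ b ∧ (G.Adj a b ∨ (a.1 = v ∧ G.Adj u b) ∨ (b.1 = v ∧ G.Adj u a))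
  symm := ⟨fun _ _ h => ⟨h.1.symm, h.2.imp Adj.symm Or.symm⟩⟩
  loopless := ⟨fun _ h => h.1 rfl⟩

lemma HasK4Minor.of_contractInto {u v : V} (huv : G.Adj u v)
    (h : HasK4Minor (contractInto G u v)) : HasK4Minor G := by
  classical
  let φ : V → {w // w ≠ u} := fun w => if hw : w = u then ⟨v, huv.ne'⟩ else ⟨w, hw⟩
  have hφ : ∀ a : {w // w ≠ u}, φ a = a := fun a => by simp [φ, a.2]
  have hφu : φ u = ⟨v, huv.ne'⟩ := by simp [φ]
  have hsurj : Function.Surjective φ := fun a => ⟨a, hφ a⟩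
  have hfib : ∀ {x y}, φ x = φ y → x = y ∨ G.Adj x y := by
    intro x y hxy
    simp only [φ] at hxy
    split_ifs at hxy with hx hy hy
    · exact .inl (hx.trans hy.symm)
    · obtain rfl : v = y := congrArg Subtype.val hxy
      exact .inr (hx ▸ huv)
    · obtain rfl : x = v := congrArg Subtype.val hxy
      exact .inr (hy ▸ huv.symm)
    · exact .inl (congrArg Subtype.val hxy)
  have hadj' : ∀ {a b}, (contractInto G u v).Adj a b →
      ∃ x y, φ x = a ∧ φ y = b ∧ G.Adj x y := by
    rintro a b ⟨_, h | ⟨h, h'⟩ | ⟨h, h'⟩⟩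
    · exact ⟨a, b, hφ a, hφ b, h⟩
    · exact ⟨u, b, hφu.trans (Subtype.ext h.symm), hφ b, h'⟩
    · exact ⟨a, u, hφ a, hφu.trans (Subtype.ext h.symm), h'.symm⟩
  obtain ⟨S, hne, hconn, hdisj, hadj⟩ := h
  refine ⟨fun i => φ ⁻¹' S i, fun i => (hne i).preimage hsurj,
    fun i => connected_induce_preimage φ hsurj hfib hadj' (hconn i),
    fun i j hij => (hdisj hij).preimage φ, fun i j hij => ?_⟩
  obtain ⟨a, ha, b, hb, hab⟩ := hadj hij
  obtain ⟨x, y, rfl, rfl, hxy⟩ := hadj' hab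
  exact ⟨x, ha, y, hb, hxy⟩

lemma HasK4Minor.of_triangle {a b c : V} (hab : G.Adj a b) (hac : G.Adj a c) (hbc : G.Adj b c)
    {C : Set V} (hC : (G.induce C).Connected) (ha : a ∉ C) (hb : b ∉ C) (hc : c ∉ C)
    (ha' : ∃ x ∈ C, G.Adj a x) (hb' : ∃ x ∈ C, G.Adj b x) (hc' : ∃ x ∈ C, G.Adj c x) :
    HasK4Minor G := by
  have hs : ∀ x : V, (G.induce {x}).Connected := fun x => Connected.of_subsingleton
  obtain ⟨x, hx, hax⟩ := ha'
  obtain ⟨y, hy, hby⟩ := hb'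
  obtain ⟨z, hz, hcz⟩ := hc'
  refine ⟨![{a}, {b}, {c}, C], ?_, ?_, ?_, ?_⟩
  · intro i
    fin_cases i
    exacts [⟨a, rfl⟩, ⟨b, rfl⟩, ⟨c, rfl⟩, ⟨x, hx⟩]
  · intro i
    fin_cases i
    exacts [hs a, hs b, hs c, hC]
  · intro i j hij
    fin_cases i <;> fin_cases j <;>
      first
        | exact absurd rfl hij
        | simp [ha, hb, hc, hab.ne, hac.ne, hbc.ne, hab.ne', hac.ne', hbc.ne']
  · have key : ∀ i j : Fin 4, i < j → ∃ p ∈ (![{a}, {b}, {c}, C] : Fin 4 → Set V) i,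
        ∃ q ∈ (![{a}, {b}, {c}, C] : Fin 4 → Set V) j, G.Adj p q := by
      intro i j hij
      fin_cases i <;> fin_cases j <;>
        first
          | exact absurd hij (by decide)
          | exact ⟨a, rfl, b, rfl, hab⟩
          | exact ⟨a, rfl, c, rfl, hac⟩
          | exact ⟨b, rfl, c, rfl, hbc⟩
          | exact ⟨a, rfl, x, hx, hax⟩
          | exact ⟨b, rfl, y, hy, hby⟩
          | exact ⟨c, rfl, z, hz, hcz⟩
    intro i j hij
    rcases lt_or_gt_of_ne hij with h | h
    · exact key i j h
    · obtain ⟨p, hp, q, hq, hpq⟩ := key j i h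
      exact ⟨q, hq, p, hp, hpq.symm⟩

/-- Every vertex outside `T` lies in a connected set avoiding `T` that is closed under
taking neighbours outside `T`. -/
lemma exists_component_avoiding [Finite V] (G : SimpleGraph V) {T : Set V} {x : V} (hx : x ∉ T) :
    ∃ C : Set V, x ∈ C ∧ (G.induce C).Connected ∧ Disjoint C T ∧
      ∀ y ∈ C, ∀ z, G.Adj y z → z ∈ C ∨ z ∈ T := by
  obtain ⟨C, hC⟩ := (Set.toFinite {C : Set V | x ∈ C ∧ (G.induce C).Connected ∧ Disjoint C T}
    ).exists_maximal ⟨{x}, rfl, Connected.of_subsingleton, by simpa using hx⟩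
  refine ⟨C, hC.prop.1, hC.prop.2.1, hC.prop.2.2, fun y hy z hyz => ?_⟩
  by_contra! hz
  have hmem : C ∪ {z} ∈ {C : Set V | x ∈ C ∧ (G.induce C).Connected ∧ Disjoint C T} := by
    refine ⟨.inl hC.prop.1, ?_, ?_⟩
    · exact connected_induce_union hC.prop.2.1.preconnected
        (Connected.of_subsingleton (G := G.induce {z})).preconnected hy rfl hyz
    · exact Set.disjoint_union_left.2 ⟨hC.prop.2.2, by simpa using hz.2⟩
  exact hz.1 (hC.le_of_ge hmem Set.subset_union_left (.inr rfl))

/-- `x` has at least three neighbours. -/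
def HasThreeNeighbors (G : SimpleGraph V) (x : V) : Prop :=
  ∃ a b c, a ≠ b ∧ a ≠ c ∧ b ≠ c ∧ G.Adj x a ∧ G.Adj x b ∧ G.Adj x c

lemma HasThreeNeighbors.contractInto_of_ne {u v x : V} (hx : HasThreeNeighbors G x) (hxu : x ≠ u)
    (hxv : x ≠ v) (huv : G.Adj u v) (htri : ∀ w, G.Adj u w → ¬ G.Adj v w) :
    HasThreeNeighbors (contractInto G u v) ⟨x, hxu⟩ := by
  classical
  obtain ⟨a, b, c, hab, hac, hbc, ha, hb, hc⟩ := hx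
  let φ : V → {w // w ≠ u} := fun w => if hw : w = u then ⟨v, huv.ne'⟩ else ⟨w, hw⟩
  have hinj : ∀ y z, G.Adj x y → G.Adj x z → y ≠ z → φ y ≠ φ z := by
    intro y z hy hz hyz h
    simp only [φ] at h
    split_ifs at h with h₁ h₂ h₂
    · exact hyz (h₁.trans h₂.symm)
    · subst h₁
      have := congrArg Subtype.val h
      subst this
      exact htri x hy.symm hz.symm
    · subst h₂
      have := congrArg Subtype.val h
      subst this
      exact htri x hz.symm hy.symm
    · exact hyz (congrArg Subtype.val h)
  have hadj : ∀ y, G.Adj x y → (contractInto G u v).Adj ⟨x, hxu⟩ (φ y) := by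
    intro y hy
    simp only [φ]
    split_ifs with h
    · subst h
      exact ⟨by simpa using hxv, .inr (.inr ⟨rfl, hy.symm⟩)⟩
    · exact ⟨by simpa using hy.ne, .inl hy⟩
  exact ⟨φ a, φ b, φ c, hinj a b ha hb hab, hinj a c ha hc hac, hinj b c hb hc hbc,
    hadj a ha, hadj b hb, hadj c hc⟩

lemma HasThreeNeighbors.exists_ne {x : V} (hx : HasThreeNeighbors G x) (y : V) :
    ∃ a b, a ≠ b ∧ a ≠ y ∧ b ≠ y ∧ G.Adj x a ∧ G.Adj x b := by
  obtain ⟨a, b, c, hab, hac, hbc, ha, hb, hc⟩ := hx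
  by_cases h₁ : a = y
  · subst h₁; exact ⟨b, c, hbc, hab.symm, hac.symm, hb, hc⟩
  by_cases h₂ : b = y
  · subst h₂; exact ⟨a, c, hac, hab, hbc.symm, ha, hc⟩
  · exact ⟨a, b, hab, h₁, h₂, ha, hb⟩

lemma HasThreeNeighbors.exists_notMem {x a b c : V} (hx : HasThreeNeighbors G x)
    (hxT : x ∈ ({a, b, c} : Set V)) : ∃ y, G.Adj x y ∧ y ∉ ({a, b, c} : Set V) := by
  obtain ⟨p, q, t, hpq, hpt, hqt, hp, hq, ht⟩ := hx
  by_contra! h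
  have hp' := h p hp
  have hq' := h q hq
  have ht' := h t ht
  have := hp.ne
  have := hq.ne
  have := ht.ne
  simp only [Set.mem_insert_iff, Set.mem_singleton_iff] at hxT hp' hq' ht'
  grind

lemma HasThreeNeighbors.contractInto_self {u v : V} (hu : HasThreeNeighbors G u)
    (hv : HasThreeNeighbors G v) (huv : G.Adj u v) (htri : ∀ w, G.Adj u w → ¬ G.Adj v w) :
    HasThreeNeighbors (contractInto G u v) ⟨v, huv.ne'⟩ := by
  obtain ⟨a, b, hab, hau, hbu, ha, hb⟩ := hv.exists_ne u
  obtain ⟨c, _, -, hcv, -, hc, -⟩ := hu.exists_ne v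
  refine ⟨⟨a, hau⟩, ⟨b, hbu⟩, ⟨c, hc.ne'⟩, by simpa using hab, ?_, ?_,
    ⟨by simpa using ha.ne, .inl ha⟩, ⟨by simpa using hb.ne, .inl hb⟩,
    ⟨by simpa using hcv.symm, .inr (.inl ⟨rfl, hc⟩)⟩⟩
  · rintro h
    have := congrArg Subtype.val h
    subst this
    exact htri _ hc ha
  · rintro h
    have := congrArg Subtype.val h
    subst this
    exact htri _ hc hb

end Minors

/-- A graph all of whose vertices, except possibly one vertex or two adjacent vertices, have
at least three neighbours has a `K₄` minor. -/
lemma hasK4Minor_of_hasThreeNeighbors {V : Type*} [Finite V] (G : SimpleGraph V) (r s : V)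
    (hrs : r = s ∨ G.Adj r s) (hne : ∃ x, x ≠ r ∧ x ≠ s)
    (h3 : ∀ x, x ≠ r → x ≠ s → HasThreeNeighbors G x) : HasK4Minor G := by
  induction hn : Nat.card V using Nat.strong_induction_on generalizing V with
  | _ n ih =>
  subst hn
  by_cases htri : ∃ a b c, G.Adj a b ∧ G.Adj a c ∧ G.Adj b c
  · by_contra hK
    -- a component attached to at most two vertices of a triangle contains a root
    have key : ∀ a b c, G.Adj a b → G.Adj a c → G.Adj b c → ∀ C : Set V, C.Nonempty →
        Disjoint C {a, b, c} → (∀ y ∈ C, ∀ z, G.Adj y z → z ∈ C ∨ z ∈ ({a, b, c} : Set V)) →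
        (∀ x ∈ C, ¬ G.Adj c x) → r ∈ C ∨ s ∈ C := by
      intro a b c hab hac hbc C hCne hCd hCc hc
      by_contra! hroot
      have haC : a ∉ C := fun h => Set.disjoint_left.1 hCd h (by simp)
      have hbC : b ∉ C := fun h => Set.disjoint_left.1 hCd h (by simp)
      have hcC : c ∉ C := fun h => Set.disjoint_left.1 hCd h (by simp)
      let W : Set V := C ∪ {a, b}
      have haW : a ∈ W := by simp [W]
      have hbW : b ∈ W := by simp [W]
      have hcW : c ∉ W := by simp [W, hcC, hac.ne', hbc.ne']
      have hlt : Nat.card W < Nat.card V := by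
        rw [Nat.card_coe_set_eq, ← Set.ncard_univ]
        exact Set.ncard_lt_ncard ((Set.ssubset_univ_iff).2 fun h => hcW (h ▸ Set.mem_univ c))
      refine hK (HasK4Minor.of_induce (s := W)
        (ih (Nat.card W) hlt (G.induce W) ⟨a, haW⟩ ⟨b, hbW⟩ (.inr hab) ?_ ?_ rfl))
      · obtain ⟨x, hx⟩ := hCne
        exact ⟨⟨x, .inl hx⟩, by rintro ⟨⟩; exact haC hx, by rintro ⟨⟩; exact hbC hx⟩
      · rintro ⟨x, hx⟩ hxa hxb
        have hxC : x ∈ C := by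
          rcases hx with hx | rfl | rfl
          · exact hx
          · exact absurd rfl hxa
          · exact absurd rfl hxb
        have hmem : ∀ y, G.Adj x y → y ∈ W := by
          intro y hy
          rcases hCc x hxC y hy with h | rfl | rfl | rfl
          · exact .inl h
          · exact haW
          · exact hbW
          · exact absurd hy.symm (hc x hxC)
        obtain ⟨p, q, t, hpq, hpt, hqt, hp, hq, ht⟩ := h3 x (by rintro rfl; exact hroot.1 hxC)
          (by rintro rfl; exact hroot.2 hxC)
        exact ⟨⟨p, hmem p hp⟩, ⟨q, hmem q hq⟩, ⟨t, hmem t ht⟩, by simpa using hpq,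
          by simpa using hpt, by simpa using hqt, hp, hq, ht⟩
    -- every component contains a root
    have key' : ∀ a b c, G.Adj a b → G.Adj a c → G.Adj b c → ∀ C : Set V, C.Nonempty →
        (G.induce C).Connected → Disjoint C {a, b, c} →
        (∀ y ∈ C, ∀ z, G.Adj y z → z ∈ C ∨ z ∈ ({a, b, c} : Set V)) → r ∈ C ∨ s ∈ C := by
      intro a b c hab hac hbc C hCne hCconn hCd hCc
      have haC : a ∉ C := fun h => Set.disjoint_left.1 hCd h (by simp)
      have hbC : b ∉ C := fun h => Set.disjoint_left.1 hCd h (by simp)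
      have hcC : c ∉ C := fun h => Set.disjoint_left.1 hCd h (by simp)
      by_contra hroot
      have h₁ : ∃ x ∈ C, G.Adj c x := by
        by_contra! h
        exact hroot (key a b c hab hac hbc C hCne hCd hCc h)
      have h₂ : ∃ x ∈ C, G.Adj b x := by
        by_contra! h
        have e : ({a, c, b} : Set V) = {a, b, c} := by rw [Set.pair_comm]
        exact hroot (key a c b hac hab hbc.symm C hCne (e ▸ hCd) (e ▸ hCc) h)
      have h₃ : ∃ x ∈ C, G.Adj a x := by
        by_contra! h
        have e : ({b, c, a} : Set V) = {a, b, c} := by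
          rw [Set.pair_comm c a, Set.insert_comm]
        exact hroot (key b c a hbc hab.symm hac.symm C hCne (e ▸ hCd) (e ▸ hCc) h)
      exact hK (HasK4Minor.of_triangle hab hac hbc hCconn haC hbC hcC h₃ h₂ h₁)
    obtain ⟨a, b, c, hab, hac, hbc⟩ := htri
    -- a root outside the triangle would have a component covering everything else
    have key'' : ∀ r s, (r = s ∨ G.Adj r s) →
        (∀ x, x ≠ r → x ≠ s → HasThreeNeighbors G x) →
        (∀ C : Set V, C.Nonempty → (G.induce C).Connected → Disjoint C {a, b, c} →
          (∀ y ∈ C, ∀ z, G.Adj y z → z ∈ C ∨ z ∈ ({a, b, c} : Set V)) → r ∈ C ∨ s ∈ C) →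
        r ∈ ({a, b, c} : Set V) := by
      intro r s hrs h3 hcomp
      by_contra hr
      obtain ⟨C, hrC, hCconn, hCd, hCc⟩ := exists_component_avoiding G hr
      have hcover : ∀ y, y ∈ {a, b, c} ∪ C := by
        intro y
        by_contra hy
        obtain ⟨D, hyD, hDconn, hDd, hDc⟩ := exists_component_avoiding G hy
        rw [Set.disjoint_union_right] at hDd
        have hDC : ∀ z ∈ D, z ∉ C := fun z hz => Set.disjoint_left.1 hDd.2 hz
        have hDT : ∀ z ∈ D, z ∉ ({a, b, c} : Set V) := fun z hz => Set.disjoint_left.1 hDd.1 hz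
        rcases hcomp D ⟨y, hyD⟩ hDconn hDd.1 (fun z hz w hzw => by
          rcases hDc z hz w hzw with h | h | h
          · exact .inl h
          · exact .inr h
          · exact ((hCc w h z hzw.symm).elim (hDC z hz) (hDT z hz)).elim) with h | h
        · exact hDC r h hrC
        · rcases hrs with rfl | hrs
          · exact hDC r h hrC
          · exact (hCc r hrC s hrs).elim (hDC s h) (hDT s h)
      have hatt : ∀ t ∈ ({a, b, c} : Set V), ∃ x ∈ C, G.Adj t x := by
        intro t ht
        by_cases hts : t = s
        · subst hts
          rcases hrs with rfl | hrs
          · exact absurd ht hr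
          · exact ⟨r, hrC, hrs.symm⟩
        · obtain ⟨y, hy, hyT⟩ := (h3 t (by rintro rfl; exact hr ht) hts).exists_notMem ht
          exact ⟨y, (hcover y).resolve_left hyT, hy⟩
      have hTC : ∀ t ∈ ({a, b, c} : Set V), t ∉ C := fun t ht h => Set.disjoint_left.1 hCd h ht
      exact hK (HasK4Minor.of_triangle hab hac hbc hCconn (hTC a (by simp)) (hTC b (by simp))
        (hTC c (by simp)) (hatt a (by simp)) (hatt b (by simp)) (hatt c (by simp)))
    have hr := key'' r s hrs h3 (key' a b c hab hac hbc)
    have hs := key'' s r (hrs.imp Eq.symm Adj.symm) (fun x hxs hxr => h3 x hxr hxs)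
      fun C h₁ h₂ h₃ h₄ => (key' a b c hab hac hbc C h₁ h₂ h₃ h₄).symm
    have hall : ∀ x, x ∈ ({a, b, c} : Set V) := by
      intro x
      by_contra hx
      obtain ⟨C, hxC, hCconn, hCd, hCc⟩ := exists_component_avoiding G hx
      rcases key' a b c hab hac hbc C ⟨x, hxC⟩ hCconn hCd hCc with h | h
      · exact Set.disjoint_left.1 hCd h hr
      · exact Set.disjoint_left.1 hCd h hs
    obtain ⟨x, hxr, hxs⟩ := hne
    obtain ⟨y, -, hy⟩ := (h3 x hxr hxs).exists_notMem (hall x)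
    exact hy (hall y)
  · push Not at htri
    obtain ⟨u, hur, hus⟩ := hne
    obtain ⟨v, _, -, -, -, huv, -⟩ := (h3 u hur hus).exists_ne u
    have htri' : ∀ w, G.Adj u w → ¬ G.Adj v w := fun w h => htri u v w huv h
    have hlt : Nat.card {w // w ≠ u} < Nat.card V :=
      Finite.card_subtype_lt (x := u) (by simp)
    refine .of_contractInto huv (ih _ hlt (contractInto G u v) ⟨r, hur.symm⟩ ⟨s, hus.symm⟩
      ?_ ?_ ?_ rfl)
    · rcases hrs with rfl | hrs
      · exact .inl rfl
      · exact .inr ⟨by simpa using hrs.ne, .inl hrs⟩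
    · obtain ⟨p, q, hpq, hpr, hqr, hp, hq⟩ := (h3 u hur hus).exists_ne r
      by_cases hps : p = s
      · subst hps
        exact ⟨⟨q, hq.ne'⟩, by simpa using hqr, by simpa using hpq.symm⟩
      · exact ⟨⟨p, hp.ne'⟩, by simpa using hpr, by simpa using hps⟩
    · rintro ⟨x, hxu⟩ hxr hxs
      have hx := h3 x (by simpa using hxr) (by simpa using hxs)
      by_cases hxv : x = v
      · subst hxv
        exact (h3 u hur hus).contractInto_self hx huv htri'
      · exact hx.contractInto_of_ne hxu hxv huv htri'

section Embedding

/-- A vector with prescribed even Hamming distances to two given vectors exists as soon as the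
obvious necessary inequalities hold. -/
lemma exists_hammingDist_eq {ι : Type*} [Fintype ι] (A B : ι → ZMod 2) {a b : ℕ}
    (ha : Even a) (hb : Even b) (hc : Even (hammingDist A B))
    (h₁ : a ≤ b + hammingDist A B) (h₂ : b ≤ a + hammingDist A B) (h₃ : hammingDist A B ≤ a + b)
    (h₄ : a + b + hammingDist A B ≤ 2 * Fintype.card ι) :
    ∃ Z : ι → ZMod 2, hammingDist Z A = a ∧ hammingDist Z B = b := by
  classical
  set S : Finset ι := {i | A i ≠ B i} with hS
  have hScard : S.card = hammingDist A B := rfl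
  have hScompl : Sᶜ.card = Fintype.card ι - S.card := Finset.card_compl S
  have hSle : S.card ≤ Fintype.card ι := Finset.card_le_univ S
  obtain ⟨a, rfl⟩ := ha
  obtain ⟨b, rfl⟩ := hb
  obtain ⟨c, hc⟩ := hc
  obtain ⟨T₁, hT₁, hT₁c⟩ := Finset.exists_subset_card_eq (s := S) (n := a + c - b) (by omega)
  obtain ⟨T₂, hT₂, hT₂c⟩ := Finset.exists_subset_card_eq (s := Sᶜ) (n := a + b - c) (by omega)
  have hflip : ∀ x y : ZMod 2, x ≠ y → x + 1 = y := by decide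
  have hdisj : Disjoint T₁ T₂ :=
    Finset.disjoint_of_subset_left hT₁ (Finset.disjoint_of_subset_right hT₂ disjoint_compl_right)
  refine ⟨fun i => if i ∈ T₁ ∪ T₂ then A i + 1 else A i, ?_, ?_⟩
  · have : hammingDist (fun i => if i ∈ T₁ ∪ T₂ then A i + 1 else A i) A = (T₁ ∪ T₂).card := by
      unfold hammingDist
      congr 1
      ext i
      simp only [Finset.mem_filter, Finset.mem_univ, true_and]
      by_cases hi : i ∈ T₁ ∪ T₂ <;> simp only [hi, if_true, if_false] <;> simp
    rw [this, Finset.card_union_of_disjoint hdisj]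
    omega
  · have : hammingDist (fun i => if i ∈ T₁ ∪ T₂ then A i + 1 else A i) B
        = (S \ T₁ ∪ T₂).card := by
      unfold hammingDist
      congr 1
      ext i
      have hi₁ : i ∈ T₁ → A i ≠ B i := fun h => by simpa [hS] using hT₁ h
      have hi₂ : i ∈ T₂ → A i = B i := fun h => by simpa [hS] using hT₂ h
      have := hflip (A i) (B i)
      simp only [hS, Finset.mem_filter, Finset.mem_univ, true_and, Finset.mem_union,
        Finset.mem_sdiff]
      by_cases h₁ : i ∈ T₁
      · have h₂ : i ∉ T₂ := fun h => hi₁ h₁ (hi₂ h)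
        simp [h₁, h₂, this (hi₁ h₁)]
      · by_cases h₂ : i ∈ T₂ <;> simp [h₁, h₂]
        simp [hi₂ h₂]
    rw [this, Finset.card_union_of_disjoint, Finset.card_sdiff_of_subset hT₁]
    · omega
    · exact Finset.disjoint_of_subset_left Finset.sdiff_subset
        (Finset.disjoint_of_subset_right hT₂ disjoint_compl_right)

lemma exists_not_hasThreeNeighbors {V : Type*} [Finite V] {G : SimpleGraph V}
    (hG : ¬ HasK4Minor G) [Nonempty V] : ∃ x, ¬ HasThreeNeighbors G x := by
  by_contra! h
  obtain ⟨r⟩ := ‹Nonempty V›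
  obtain ⟨a, -, -, -, -, -, ha, -⟩ := h r
  exact hG (hasK4Minor_of_hasThreeNeighbors G r r (.inl rfl) ⟨a, ha.ne', ha.ne'⟩
    fun x _ _ => h x)

/-- A `K₄`-minor-free graph whose vertices carry an even-valued semimetric with triangles of
perimeter at most `2n` maps to the `n`-cube so that edges keep their length. -/
lemma exists_hammingDist_eq_of_adj {n : ℕ} {V : Type*} [Finite V] (G : SimpleGraph V)
    (hG : ¬ HasK4Minor G) (d : V → V → ℕ) (heven : ∀ u v, Even (d u v))
    (hsymm : ∀ u v, d u v = d v u) (hle : ∀ u v, d u v ≤ n)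
    (htri : ∀ u v w, d u w ≤ d u v + d v w)
    (hper : ∀ u v w, d u v + d v w + d u w ≤ 2 * n) :
    ∃ f : V → Fin n → ZMod 2, ∀ u v, G.Adj u v → hammingDist (f u) (f v) = d u v := by
  classical
  induction hn : Nat.card V using Nat.strong_induction_on generalizing V with
  | _ N ih =>
  subst hn
  rcases isEmpty_or_nonempty V with hV | hV
  · exact ⟨fun _ => 0, fun u => (hV.false u).elim⟩
  obtain ⟨x, hx⟩ := exists_not_hasThreeNeighbors hG
  have hlt : Nat.card {w // w ≠ x} < Nat.card V := Finite.card_subtype_lt (x := x) (by simp)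
  -- an embedding of the other vertices can be extended to `x`
  have extend : ∀ (H : SimpleGraph {w // w ≠ x}), ¬ HasK4Minor H →
      (∀ a b : {w // w ≠ x}, G.Adj a b → H.Adj a b) →
      (∀ f : {w // w ≠ x} → Fin n → ZMod 2,
        (∀ u v, H.Adj u v → hammingDist (f u) (f v) = d u v) →
        ∃ Z, ∀ y : {w // w ≠ x}, G.Adj x y → hammingDist Z (f y) = d x y) →
      ∃ f : V → Fin n → ZMod 2, ∀ u v, G.Adj u v → hammingDist (f u) (f v) = d u v := by
    intro H hH hGH hext
    obtain ⟨f, hf⟩ := ih _ hlt H hH (fun a b => d a b) (fun _ _ => heven _ _)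
      (fun _ _ => hsymm _ _) (fun _ _ => hle _ _) (fun _ _ _ => htri _ _ _)
      (fun _ _ _ => hper _ _ _) rfl
    obtain ⟨Z, hZ⟩ := hext f hf
    refine ⟨fun v => if hv : v = x then Z else f ⟨v, hv⟩, fun u v huv => ?_⟩
    by_cases hu : u = x
    · subst hu
      have hv : v ≠ u := huv.ne'
      simpa [hv] using hZ ⟨v, hv⟩ huv
    · by_cases hv : v = x
      · subst hv
        rw [hsymm u v, hammingDist_comm]
        simpa [hu] using hZ ⟨u, hu⟩ huv.symm
      · simpa [hu, hv] using hf ⟨u, hu⟩ ⟨v, hv⟩ (hGH _ _ huv)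
  by_cases hp : ∃ p, G.Adj x p
  · obtain ⟨p, hp⟩ := hp
    obtain ⟨q, hq, hpq⟩ : ∃ q, G.Adj x q ∧ ∀ y, G.Adj x y → y = p ∨ y = q := by
      by_contra! h
      obtain ⟨y, hy, hyp, -⟩ := h p hp
      obtain ⟨z, hz, hzp, hzy⟩ := h y hy
      exact hx ⟨p, y, z, hyp.symm, hzp.symm, hzy.symm, hp, hy, hz⟩
    refine extend (contractInto G x p) (fun h => hG (.of_contractInto hp h))
      (fun a b h => ⟨fun e => h.ne (congrArg _ e), .inl h⟩) fun f hf => ?_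
    have hd : hammingDist (f ⟨p, hp.ne'⟩) (f ⟨q, hq.ne'⟩) = if p = q then 0 else d p q := by
      split_ifs with h
      · subst h; simp
      · exact hf ⟨p, hp.ne'⟩ ⟨q, hq.ne'⟩ ⟨by simpa using h, .inr (.inl ⟨rfl, hq⟩)⟩
    obtain ⟨Z, hZp, hZq⟩ := exists_hammingDist_eq (f ⟨p, hp.ne'⟩) (f ⟨q, hq.ne'⟩)
      (heven x p) (heven x q)
      (by rw [hd]; split_ifs; exacts [by simp, heven p q])
      (by
        rw [hd]; split_ifs with h
        · simp [h]
        · rw [hsymm p q]; exact htri x q p)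
      (by
        rw [hd]; split_ifs with h
        · simp [h]
        · exact htri x p q)
      (by
        rw [hd]; split_ifs with h
        · simp
        · rw [hsymm x p]; exact htri p x q)
      (by
        rw [hd, Fintype.card_fin]; split_ifs with h
        · have := hle x p
          have := hle x q
          omega
        · rw [hsymm x p]; exact hper p x q)
    refine ⟨Z, fun y hy => ?_⟩
    rcases hpq y hy with h | h
    · obtain rfl : y = ⟨p, hp.ne'⟩ := Subtype.ext h
      exact hZp
    · obtain rfl : y = ⟨q, hq.ne'⟩ := Subtype.ext h
      exact hZq
  · push Not at hp
    exact extend (G.induce {w | w ≠ x}) (fun h => hG h.of_induce) (fun a b h => h)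
      fun f _ => ⟨0, fun y hy => absurd hy (hp y)⟩

/-- Adding the last coordinate to all the others maps pairs of points of the `(2k+1)`-cube at
distance `2k` to edges of `PC(2k)`. -/
lemma PC_adj_of_hammingDist_eq {k : ℕ} (hk : 1 ≤ k) {A B : Fin (2 * k + 1) → ZMod 2}
    (h : hammingDist A B = 2 * k) :
    (PC k).Adj (fun i => A i.castSucc + A (Fin.last _)) fun i => B i.castSucc + B (Fin.last _) := by
  have hc : (Finset.univ.filter fun i => A i = B i).card = 1 := by
    have := Finset.card_filter_add_card_filter_not (s := Finset.univ) fun i => A i = B i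
    rw [Finset.card_univ, Fintype.card_fin] at this
    unfold hammingDist at h
    simp only [ne_eq] at h
    omega
  obtain ⟨j, hj⟩ := Finset.card_eq_one.1 hc
  have hj' : ∀ i, A i = B i ↔ i = j := fun i => by
    simpa using congrArg (i ∈ ·) hj
  have hflip : ∀ x y : ZMod 2, x ≠ y → y = x + 1 := by decide
  have htwo : (1 : ZMod 2) + 1 = 0 := by decide
  have key : (∃ i : Fin (2 * k), (fun i : Fin (2 * k) => B i.castSucc + B (Fin.last _)) =
      (fun i => A i.castSucc + A (Fin.last _)) + fun j => if j = i then 1 else 0) ∨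
      (fun i : Fin (2 * k) => B i.castSucc + B (Fin.last _)) =
      (fun i => A i.castSucc + A (Fin.last _)) + fun _ => 1 := by
    induction j using Fin.lastCases with
    | last =>
      right
      funext i
      have h₁ := (hj' (Fin.last _)).2 rfl
      have h₂ := hflip _ _ ((hj' i.castSucc).not.2 (Fin.castSucc_lt_last i).ne)
      simp only [Pi.add_apply]
      rw [h₂, ← h₁]
      ring
    | cast j =>
      left
      refine ⟨j, funext fun i => ?_⟩
      have h₁ := hflip _ _ ((hj' (Fin.last _)).not.2 (Fin.castSucc_lt_last j).ne')
      simp only [Pi.add_apply]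
      split_ifs with hij
      · subst hij
        rw [h₁, ← (hj' i.castSucc).2 rfl]
        ring
      · have h₂ := hflip _ _ ((hj' i.castSucc).not.2 (by simpa using hij))
        rw [h₁, h₂]
        linear_combination htwo
  refine (SimpleGraph.fromRel_adj _ _ _).2 ⟨fun e => ?_, .inl key⟩
  rw [← e] at key
  rcases key with ⟨i, hi⟩ | h1
  · have := congrFun hi i
    simp at this
  · have := congrFun h1 ⟨0, by omega⟩
    simp at this

end Embedding

/-- Every finite `K₄`-minor-free graph of odd-girth at least `2k+1` admits a
homomorphism to the projective hypercube `PC(2k)`. -/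
theorem SP_to_PC {V : Type*} [Fintype V] (k : ℕ) (hk : 1 ≤ k) (G : SimpleGraph V)
    (h1 : ¬ HasK4Minor G) (h2 : oddGirthAtLeast G (2*k+1)) :
    Nonempty (G →g PC k) := by
  obtain ⟨d, heven, hsymm, hle, htri, hper, hadj⟩ := exists_even_semimetric k G h2
  obtain ⟨f, hf⟩ := exists_hammingDist_eq_of_adj G h1 d heven hsymm
    (fun u v => (hle u v).trans (Nat.le_succ _)) htri hper
  exact ⟨⟨fun v i => f v i.castSucc + f v (Fin.last _), fun {u v} h =>
    PC_adj_of_hammingDist_eq hk ((hf u v h).trans (hadj u v h))⟩⟩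
end

section
/- Every K_4-minor-free graph of odd-girth at least 7 admits a homomorphism to the graph X_{15}, built from a 10-cycle v₀v₁…v₉ by adding five vertices x₀,…,x₄ with x_i adjacent to v_i and v_{i+5}. -/
open SimpleGraph

/-- Base adjacency of the graph `X₁₅`: a 10-cycle `v₀…v₉` (the `Sum.inl` vertices,
on `ZMod 10`) plus five vertices `x₀,…,x₄` (the `Sum.inr` vertices) with `xᵢ`
adjacent to `vᵢ` and `v_{i+5}`. -/
def X15AdjBase : (ZMod 10 ⊕ Fin 5) → (ZMod 10 ⊕ Fin 5) → Prop
  | Sum.inl a, Sum.inl b => b = a + 1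
  | Sum.inr i, Sum.inl a => a = ((i : ℕ) : ZMod 10) ∨ a = ((i : ℕ) : ZMod 10) + 5
  | _, _ => False

/-- The graph `X₁₅`. -/
def X15 : SimpleGraph (ZMod 10 ⊕ Fin 5) := SimpleGraph.fromRel X15AdjBase

namespace SimpleGraph

variable {V : Type*}

section Connectivity

theorem Connected.induce_mono_graph {G H : SimpleGraph V} {s : Set V}
    (hs : (G.induce s).Connected) (hle : G ≤ H) : (H.induce s).Connected :=
  hs.mono fun _ _ h => hle h

theorem induce_singleton_connected (G : SimpleGraph V) (v : V) :
    (G.induce {v}).Connected := by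
  refine (connected_iff_exists_forall_reachable _).mpr ⟨⟨v, rfl⟩, ?_⟩
  rintro ⟨w, rfl⟩
  rfl

theorem induce_insert_connected {G : SimpleGraph V} {s : Set V} {u v : V}
    (hs : (G.induce s).Connected) (hu : u ∈ s) (huv : G.Adj u v) :
    (G.induce (insert v s)).Connected := by
  rw [Set.insert_eq]
  exact connected_induce_union (w := u) (v := v) (G.induce_singleton_connected v).preconnected
    hs.preconnected rfl hu huv.symm

/-- A connected subset of an induced subgraph is connected in the ambient graph. -/
theorem Connected.image_val {G : SimpleGraph V} {C : Set V} {P : Set C}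
    (hP : ((G.induce C).induce P).Connected) :
    (G.induce (Subtype.val '' P)).Connected := by
  refine hP.map ⟨fun x => ⟨x.1.1, x.1, x.2, rfl⟩, fun h => h⟩ ?_
  rintro ⟨_, x, hx, rfl⟩
  exact ⟨⟨x, hx⟩, rfl⟩

theorem Connected.exists_adj_boundary {G : SimpleGraph V} (hG : G.Connected) {s : Set V}
    {a b : V} (ha : a ∈ s) (hb : b ∉ s) : ∃ u ∈ s, ∃ v ∉ s, G.Adj u v := by
  obtain ⟨p⟩ := hG.preconnected a b
  obtain ⟨d, -, h1, h2⟩ := p.exists_boundary_dart s ha hb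
  exact ⟨d.fst, h1, d.snd, h2, d.adj⟩

/-- In a connected graph, one of two disjoint connected sets can be enlarged until it is
adjacent to the other one. -/
theorem Connected.exists_superset_adj [Finite V] {G : SimpleGraph V} (hG : G.Connected)
    {P Q : Set V} (hdisj : Disjoint P Q) (hP : P.Nonempty) (hQ : (G.induce Q).Connected) :
    ∃ Q' : Set V, Q ⊆ Q' ∧ Disjoint P Q' ∧ (G.induce Q').Connected ∧
      ∃ u ∈ P, ∃ v ∈ Q', G.Adj u v := by
  obtain ⟨M, hQM, ⟨hMdisj, hM⟩, hmax⟩ :=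
    (Set.toFinite {S : Set V | Disjoint P S ∧ (G.induce S).Connected}).exists_le_maximal
      (a := Q) ⟨hdisj, hQ⟩
  obtain ⟨a, ha⟩ := hP
  obtain ⟨⟨m, hm⟩⟩ := hM.nonempty
  obtain ⟨u, hu, v, hv, huv⟩ :=
    hG.exists_adj_boundary hm (Set.disjoint_left.mp hMdisj ha)
  refine ⟨M, hQM, hMdisj, hM, v, ?_, u, hu, huv.symm⟩
  by_contra hvP
  exact hv (hmax (y := insert v M)
    ⟨Set.disjoint_insert_right.mpr ⟨hvP, hMdisj⟩, induce_insert_connected hM hu huv⟩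
    (Set.subset_insert _ _) (Set.mem_insert _ _))

/-- One side of a separation of order one of a connected graph is connected. -/
theorem Connected.induce_of_cut {G : SimpleGraph V} (hG : G.Connected) {L R : Set V} {z : V}
    (hLR : L ∩ R = {z}) (hcut : ∀ u v, u ∉ R → v ∉ L → ¬ G.Adj u v) :
    (G.induce R).Connected := by
  have hz : z ∈ L ∩ R := hLR ▸ rfl
  refine (connected_iff_exists_forall_reachable _).mpr ⟨⟨z, hz.2⟩, ?_⟩
  suffices h : ∀ v, ∀ hv : v ∈ R, (G.induce R).Reachable ⟨z, hz.2⟩ ⟨v, hv⟩ from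
    fun w => h w.1 w.2
  intro v
  induction (reachable_iff_reflTransGen _ _).mp (hG.preconnected z v) with
  | refl => intro hv; rfl
  | @tail u w _ huw ih =>
    intro hw
    by_cases hwz : w = z
    · subst hwz; rfl
    · have hwL : w ∉ L := fun h => hwz (hLR ▸ (⟨h, hw⟩ : w ∈ L ∩ R) : w ∈ ({z} : Set V))
      have hu : u ∈ R := by
        by_contra hu
        exact hcut u w hu hwL huw
      exact (ih hu).trans (Adj.reachable (G := G.induce R) huw)

end Connectivity

section Linkage

/-- The sets `A` and `B` are separated by a single vertex `z`. -/
def HasCutVertex (H : SimpleGraph V) (A B : Set V) : Prop :=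
  ∃ (z : V) (L R : Set V), L ∪ R = Set.univ ∧ L ∩ R = {z} ∧ A ⊆ L ∧ B ⊆ R ∧
    ∀ u v, u ∉ R → v ∉ L → ¬ H.Adj u v

/-- There are two disjoint connected sets, each meeting both `A` and `B`. -/
def HasTwoLinkage (H : SimpleGraph V) (A B : Set V) : Prop :=
  ∃ P Q : Set V, Disjoint P Q ∧ (H.induce P).Connected ∧ (H.induce Q).Connected ∧
    (P ∩ A).Nonempty ∧ (P ∩ B).Nonempty ∧ (Q ∩ A).Nonempty ∧ (Q ∩ B).Nonempty

theorem HasCutVertex.symm {H : SimpleGraph V} {A B : Set V} (h : H.HasCutVertex A B) :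
    H.HasCutVertex B A := by
  obtain ⟨z, L, R, h1, h2, h3, h4, h5⟩ := h
  exact ⟨z, R, L, Set.union_comm L R ▸ h1, Set.inter_comm L R ▸ h2, h4, h3,
    fun u v hu hv huv => h5 v u hv hu huv.symm⟩

/-- The edges of `H` with both ends in `S`, as a graph on the same vertex set. -/
def keepEdgesIn (H : SimpleGraph V) (S : Set V) : SimpleGraph V where
  Adj u v := H.Adj u v ∧ u ∈ S ∧ v ∈ S
  symm := ⟨fun _ _ h => ⟨h.1.symm, h.2.2, h.2.1⟩⟩
  loopless := ⟨fun _ h => H.loopless.irrefl _ h.1⟩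

theorem keepEdgesIn_le (H : SimpleGraph V) (S : Set V) : H.keepEdgesIn S ≤ H :=
  fun _ _ h => h.1

theorem subset_of_connected_keepEdgesIn {H : SimpleGraph V} {S P : Set V} {a : V}
    (hP : ((H.keepEdgesIn S).induce P).Connected) (haP : a ∈ P) (haS : a ∈ S) : P ⊆ S := by
  intro b hb
  by_contra hbS
  obtain ⟨u, -, v, hv, huv⟩ :=
    hP.exists_adj_boundary (s := {x | x.1 ∈ S}) (a := ⟨a, haP⟩) (b := ⟨b, hb⟩) haS hbS
  exact hv huv.2.2

/-- One half of the induction step of Menger's theorem for two paths. -/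
theorem hasCutVertex_or_linkage_of_side {H : SimpleGraph V} {A B L R : Set V} {z x : V}
    (hcover : L ∪ R = Set.univ) (hLR : L ∩ R = {z}) (hA : A ⊆ L) (hB : B ⊆ R)
    (hxR : x ∉ R) (hcross : ∀ u v, u ∉ R → v ∉ L → H.Adj u v → u = x)
    (hside : (H.keepEdgesIn L).HasCutVertex A {z, x} ∨
      (H.keepEdgesIn L).HasTwoLinkage A {z, x}) :
    H.HasCutVertex A B ∨ ∃ P Q : Set V, Disjoint P Q ∧ (H.induce P).Connected ∧
      (H.induce Q).Connected ∧ P ⊆ L ∧ Q ⊆ L ∧ z ∈ P ∧ x ∈ Q ∧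
      (P ∩ A).Nonempty ∧ (Q ∩ A).Nonempty := by
  rcases hside with ⟨w, L', R', hcover', hLR', hA', hzx, hcut⟩ |
    ⟨P, Q, hd, hP, hQ, ⟨p, hpP, hpA⟩, ⟨p', hp'P, hp'⟩, ⟨q, hqQ, hqA⟩, ⟨q', hq'Q, hq'⟩⟩
  · left
    have hzR' : z ∈ R' := hzx (by simp)
    have hxR' : x ∈ R' := hzx (by simp)
    have hw : w ∈ L' ∩ R' := hLR' ▸ rfl
    have hz : ∀ v, v ∈ L → v ∈ R → v = z := fun v h1 h2 =>
      (hLR ▸ (⟨h1, h2⟩ : v ∈ L ∩ R) : v ∈ ({z} : Set V))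
    have hw' : ∀ v, v ∈ L' → v ∈ R' → v = w := fun v h1 h2 =>
      (hLR' ▸ (⟨h1, h2⟩ : v ∈ L' ∩ R') : v ∈ ({w} : Set V))
    have hc : ∀ v, v ∈ L ∨ v ∈ R := fun v =>
      (hcover.symm ▸ Set.mem_univ v : v ∈ L ∪ R)
    have hc' : ∀ v, v ∈ L' ∨ v ∈ R' := fun v =>
      (hcover'.symm ▸ Set.mem_univ v : v ∈ L' ∪ R')
    refine ⟨w, insert w (L ∩ L'), R' ∪ R, ?_, ?_, ?_, ?_, ?_⟩
    · ext v
      have := hc v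
      have := hc' v
      simp only [Set.mem_union, Set.mem_insert_iff, Set.mem_inter_iff, Set.mem_univ]
      tauto
    · ext v
      simp only [Set.mem_union, Set.mem_insert_iff, Set.mem_inter_iff, Set.mem_singleton_iff]
      constructor
      · rintro ⟨rfl | ⟨h1, h2⟩, h3 | h3⟩
        · rfl
        · rfl
        · exact hw' v h2 h3
        · have := hz v h1 h3
          subst this
          exact hw' v h2 hzR'
      · rintro rfl
        exact ⟨Or.inl rfl, Or.inl hw.2⟩
    · exact fun v hv => Or.inr ⟨hA hv, hA' hv⟩
    · exact fun v hv => Or.inr (hB hv)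
    · intro u v hu hv huv
      simp only [Set.mem_union, Set.mem_insert_iff, Set.mem_inter_iff, not_or] at hu hv
      have huL : u ∈ L := (hc u).resolve_right hu.2
      have hvL : v ∈ L := by
        by_contra hvL
        exact hu.1 (hcross u v hu.2 hvL huv ▸ hxR')
      exact hcut u v hu.1 (fun h => hv.2 ⟨hvL, h⟩) ⟨huv, huL, hvL⟩
  · right
    have hPL := subset_of_connected_keepEdgesIn hP hpP (hA hpA)
    have hQL := subset_of_connected_keepEdgesIn hQ hqQ (hA hqA)
    replace hP := hP.induce_mono_graph (keepEdgesIn_le H L)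
    replace hQ := hQ.induce_mono_graph (keepEdgesIn_le H L)
    have hne : p' ≠ q' := fun h => Set.disjoint_left.mp hd hp'P (h ▸ hq'Q)
    rcases hp' with rfl | rfl <;> rcases hq' with rfl | rfl
    · exact absurd rfl hne
    · exact ⟨P, Q, hd, hP, hQ, hPL, hQL, hp'P, hq'Q, ⟨p, hpP, hpA⟩, ⟨q, hqQ, hqA⟩⟩
    · exact ⟨Q, P, hd.symm, hQ, hP, hQL, hPL, hq'Q, hp'P, ⟨q, hqQ, hqA⟩, ⟨p, hpP, hpA⟩⟩
    · exact absurd rfl hne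

/-- Menger's theorem for two paths: two vertex sets are separated by a single vertex or
joined by two disjoint connected sets. -/
theorem hasCutVertex_or_hasTwoLinkage [Finite V] [Nonempty V] (H : SimpleGraph V) :
    ∀ A B : Set V, H.HasCutVertex A B ∨ H.HasTwoLinkage A B := by
  induction H using WellFoundedLT.induction with
  | ind H ih =>
  intro A B
  by_cases hH : ∃ x y, H.Adj x y
  · obtain ⟨x, y, hxy⟩ := hH
    have hlt : H.deleteEdges {s(x, y)} < H :=
      lt_of_le_of_ne (deleteEdges_le _) fun h => by
        have := h.symm ▸ hxy
        simp at this
    rcases ih _ hlt A B with ⟨z, L, R, hcover, hLR, hA, hB, hcut⟩ |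
      ⟨P, Q, hd, hP, hQ, h⟩
    swap
    · exact Or.inr ⟨P, Q, hd, hP.induce_mono_graph hlt.le, hQ.induce_mono_graph hlt.le, h⟩
    by_cases hcross : ∃ u v, u ∉ R ∧ v ∉ L ∧ H.Adj u v
    swap
    · push Not at hcross
      exact Or.inl ⟨z, L, R, hcover, hLR, hA, hB, hcross⟩
    obtain ⟨x', y', hx, hy, hxy'⟩ := hcross
    have hdel : ∀ u v, u ∉ R → v ∉ L → H.Adj u v → s(u, v) = s(x, y) := by
      intro u v hu hv huv
      by_contra hne
      exact hcut u v hu hv (by simpa [deleteEdges_adj] using ⟨huv, by simpa using hne⟩)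
    have hyR : y' ∈ R := ((hcover.symm ▸ Set.mem_univ y' : y' ∈ L ∪ R)).resolve_left hy
    have hxL : x' ∈ L := ((hcover.symm ▸ Set.mem_univ x' : x' ∈ L ∪ R)).resolve_right hx
    have huniq : ∀ u v, u ∉ R → v ∉ L → H.Adj u v → u = x' ∧ v = y' := by
      intro u v hu hv huv
      have h := (hdel u v hu hv huv).trans (hdel x' y' hx hy hxy').symm
      rcases Sym2.eq_iff.mp h with h | ⟨rfl, rfl⟩
      · exact h
      · exact absurd hyR hu
    have hltL : H.keepEdgesIn L < H :=
      lt_of_le_of_ne (keepEdgesIn_le H L) fun h =>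
        hy (h.symm ▸ hxy' : (H.keepEdgesIn L).Adj x' y').2.2
    have hltR : H.keepEdgesIn R < H :=
      lt_of_le_of_ne (keepEdgesIn_le H R) fun h =>
        hx (h.symm ▸ hxy' : (H.keepEdgesIn R).Adj x' y').2.1
    rcases hasCutVertex_or_linkage_of_side hcover hLR hA hB hx
      (fun u v hu hv huv => (huniq u v hu hv huv).1) (ih _ hltL A {z, x'}) with h |
      ⟨P, Q, hd, hP, hQ, hPL, hQL, hzP, hxQ, hPA, hQA⟩
    · exact Or.inl h
    rcases hasCutVertex_or_linkage_of_side (Set.union_comm L R ▸ hcover)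
      (Set.inter_comm L R ▸ hLR) hB hA hy
      (fun u v hu hv huv => (huniq v u hv hu huv.symm).2) (ih _ hltR B {z, y'}) with h |
      ⟨P', Q', hd', hP', hQ', hPR, hQR, hzP', hyQ', hPB, hQB⟩
    · exact Or.inl h.symm
    have hz : ∀ v, v ∈ L → v ∈ R → v = z := fun v h1 h2 =>
      (hLR ▸ (⟨h1, h2⟩ : v ∈ L ∩ R) : v ∈ ({z} : Set V))
    refine Or.inr ⟨P ∪ P', Q ∪ Q', ?_,
      induce_union_connected hP.preconnected hP'.preconnected ⟨z, hzP, hzP'⟩,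
      connected_induce_union hQ.preconnected hQ'.preconnected hxQ hyQ' hxy',
      hPA.mono (by gcongr; exact Set.subset_union_left),
      hPB.mono (by gcongr; exact Set.subset_union_right),
      hQA.mono (by gcongr; exact Set.subset_union_left),
      hQB.mono (by gcongr; exact Set.subset_union_right)⟩
    rw [Set.disjoint_left] at hd hd' ⊢
    rintro v (hv | hv) (hv' | hv')
    · exact hd hv hv'
    · exact hd' hzP' (hz v (hPL hv) (hQR hv') ▸ hv')
    · exact hd hzP (hz v (hQL hv') (hPR hv) ▸ hv')
    · exact hd' hv hv'
  · push Not at hH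
    by_cases hAB : (A ∩ B).Subsingleton
    · left
      obtain ⟨z, hz⟩ : ∃ z, A ∩ B ⊆ {z} := by
        rcases hAB.eq_empty_or_singleton with h | ⟨z, h⟩
        · exact ⟨Classical.arbitrary V, by simp [h]⟩
        · exact ⟨z, h.subset⟩
      refine ⟨z, insert z A, insert z Aᶜ, ?_, ?_, Set.subset_insert _ _, ?_,
        fun u v _ _ => hH u v⟩
      · ext v
        by_cases v ∈ A <;> simp [*]
      · ext v
        simp only [Set.mem_inter_iff, Set.mem_insert_iff, Set.mem_compl_iff,
          Set.mem_singleton_iff]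
        tauto
      · intro b hb
        by_cases hbA : b ∈ A
        · exact Or.inl (hz ⟨hbA, hb⟩)
        · exact Or.inr hbA
    · right
      obtain ⟨p, hp, q, hq, hpq⟩ := Set.not_subsingleton_iff.mp hAB
      exact ⟨{p}, {q}, by simpa using hpq, H.induce_singleton_connected p,
        H.induce_singleton_connected q, ⟨p, rfl, hp.1⟩, ⟨p, rfl, hp.2⟩,
        ⟨q, rfl, hq.1⟩, ⟨q, rfl, hq.2⟩⟩

end Linkage

section Extension

/-- Outside of `C`, the vertices `a` and `b` lie in disjoint connected sets that are adjacent. -/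
def AdjacentOutside (G : SimpleGraph V) (C : Set V) (a b : V) : Prop :=
  ∃ A B : Set V, a ∈ A ∧ b ∈ B ∧ Disjoint A B ∧ Disjoint A C ∧ Disjoint B C ∧
    (G.induce A).Connected ∧ (G.induce B).Connected ∧ ∃ u ∈ A, ∃ v ∈ B, G.Adj u v

theorem AdjacentOutside.symm {G : SimpleGraph V} {C : Set V} {a b : V}
    (h : G.AdjacentOutside C a b) : G.AdjacentOutside C b a := by
  obtain ⟨A, B, ha, hb, hAB, hA, hB, cA, cB, u, hu, v, hv, huv⟩ := h
  exact ⟨B, A, hb, ha, hAB.symm, hB, hA, cB, cA, v, hv, u, hu, huv.symm⟩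

theorem AdjacentOutside.mono {G : SimpleGraph V} {C D : Set V} {a b : V}
    (h : G.AdjacentOutside C a b) (hDC : D ⊆ C) : G.AdjacentOutside D a b := by
  obtain ⟨A, B, ha, hb, hAB, hA, hB, h⟩ := h
  exact ⟨A, B, ha, hb, hAB, hA.mono_right hDC, hB.mono_right hDC, h⟩

theorem Adj.adjacentOutside {G : SimpleGraph V} {C : Set V} {a b : V} (h : G.Adj a b)
    (ha : a ∉ C) (hb : b ∉ C) : G.AdjacentOutside C a b :=
  ⟨{a}, {b}, rfl, rfl, by simpa using h.ne, by simpa using ha, by simpa using hb,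
    G.induce_singleton_connected a, G.induce_singleton_connected b, a, rfl, b, rfl, h⟩

theorem hasK4Minor_of_four {G : SimpleGraph V} {A B C D : Set V}
    (cA : (G.induce A).Connected) (cB : (G.induce B).Connected)
    (cC : (G.induce C).Connected) (cD : (G.induce D).Connected)
    (dAB : Disjoint A B) (dAC : Disjoint A C) (dAD : Disjoint A D)
    (dBC : Disjoint B C) (dBD : Disjoint B D) (dCD : Disjoint C D)
    (aAB : ∃ u ∈ A, ∃ v ∈ B, G.Adj u v) (aAC : ∃ u ∈ A, ∃ v ∈ C, G.Adj u v)
    (aAD : ∃ u ∈ A, ∃ v ∈ D, G.Adj u v) (aBC : ∃ u ∈ B, ∃ v ∈ C, G.Adj u v)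
    (aBD : ∃ u ∈ B, ∃ v ∈ D, G.Adj u v) (aCD : ∃ u ∈ C, ∃ v ∈ D, G.Adj u v) :
    HasK4Minor G := by
  have hsymm : ∀ {S T : Set V}, (∃ u ∈ S, ∃ v ∈ T, G.Adj u v) → ∃ u ∈ T, ∃ v ∈ S, G.Adj u v :=
    fun ⟨u, hu, v, hv, h⟩ => ⟨v, hv, u, hu, h.symm⟩
  have hconn : ∀ i, (G.induce (![A, B, C, D] i)).Connected := by
    intro i
    fin_cases i <;> assumption
  refine ⟨![A, B, C, D], fun i => Set.nonempty_coe_sort.mp (hconn i).nonempty, hconn, ?_, ?_⟩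
  · intro i j hij
    fin_cases i <;> fin_cases j <;>
      first | exact absurd rfl hij | assumption | (apply Disjoint.symm; assumption)
  · intro i j hij
    fin_cases i <;> fin_cases j <;>
      first | exact absurd rfl hij | assumption | (apply hsymm; assumption)

/-- Two disjoint paths through a connected set `C` between the neighbours of `a` and those of
`b` give a `K₄` minor if `a` and `b` are adjacent outside of `C`. -/
theorem AdjacentOutside.hasK4Minor_of_hasTwoLinkage [Finite V] {G : SimpleGraph V} {C : Set V}
    {a b : V} (h : G.AdjacentOutside C a b) (hC : (G.induce C).Connected)
    (hlink : (G.induce C).HasTwoLinkage {u | G.Adj a u} {u | G.Adj b u}) : HasK4Minor G := by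
  obtain ⟨A, B, ha, hb, hAB, hA, hB, cA, cB, hadj⟩ := h
  obtain ⟨P, Q, hd, cP, cQ, ⟨p, hp, hap⟩, ⟨p', hp', hbp⟩, ⟨q, hq, haq⟩, ⟨q', hq', hbq⟩⟩ := hlink
  obtain ⟨Q', hQQ', hd', cQ', u, hu, v, hv, huv⟩ := hC.exists_superset_adj hd ⟨p, hp⟩ cQ
  have hsub : ∀ S : Set C, Subtype.val '' S ⊆ C := fun S => by
    rintro _ ⟨x, -, rfl⟩
    exact x.2
  exact hasK4Minor_of_four cA cB cP.image_val cQ'.image_val hAB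
    (hA.mono_right (hsub P)) (hA.mono_right (hsub Q')) (hB.mono_right (hsub P))
    (hB.mono_right (hsub Q')) ((Set.disjoint_image_iff Subtype.val_injective).mpr hd') hadj
    ⟨a, ha, p, ⟨p, hp, rfl⟩, hap⟩ ⟨a, ha, q, ⟨q, hQQ' hq, rfl⟩, haq⟩
    ⟨b, hb, p', ⟨p', hp', rfl⟩, hbp⟩ ⟨b, hb, q', ⟨q', hQQ' hq', rfl⟩, hbq⟩
    ⟨u, ⟨u, hu, rfl⟩, v, ⟨v, hv, rfl⟩, huv⟩

/-- A cut vertex `z` of `C` inherits from `b` the adjacency to `a` outside of one side. -/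
theorem AdjacentOutside.of_cut {G : SimpleGraph V} {C : Set V} {a b : V}
    (h : G.AdjacentOutside C a b) (hC : (G.induce C).Connected) {L R : Set C} {z : C}
    (hLR : L ∩ R = {z}) (hcut : ∀ u v, u ∉ R → v ∉ L → ¬ (G.induce C).Adj u v)
    (hb : ∃ u ∈ R, G.Adj b u) :
    G.AdjacentOutside (Subtype.val '' Rᶜ) a z := by
  obtain ⟨A, B, ha, hbB, hAB, hA, hB, cA, cB, u, hu, v, hv, huv⟩ := h
  obtain ⟨r, hr, hbr⟩ := hb
  have hz : z ∈ L ∩ R := hLR ▸ rfl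
  have hsub : ∀ S : Set C, Subtype.val '' S ⊆ C := fun S => by
    rintro _ ⟨x, -, rfl⟩
    exact x.2
  refine ⟨A, B ∪ Subtype.val '' R, ha, Or.inr ⟨z, hz.2, rfl⟩,
    Set.disjoint_union_right.mpr ⟨hAB, hA.mono_right (hsub R)⟩, hA.mono_right (hsub _),
    Set.disjoint_union_left.mpr ⟨hB.mono_right (hsub _), ?_⟩, cA,
    connected_induce_union cB.preconnected
      (hC.induce_of_cut hLR hcut).image_val.preconnected hbB ⟨r, hr, rfl⟩ hbr,
    u, hu, v, Or.inl hv, huv⟩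
  exact (Set.disjoint_image_iff Subtype.val_injective).mpr disjoint_compl_right

/-- A set of vertices that is not connected splits into two parts without edges between. -/
theorem exists_split_of_not_connected {G : SimpleGraph V} {C : Set V} (hne : C.Nonempty)
    (hC : ¬ (G.induce C).Connected) : ∃ C₁ C₂ : Set V, C₁ ∪ C₂ = C ∧ Disjoint C₁ C₂ ∧
      C₁.Nonempty ∧ C₂.Nonempty ∧ ∀ u ∈ C₁, ∀ v ∈ C₂, ¬ G.Adj u v := by
  obtain ⟨c, hc⟩ := hne
  rw [connected_iff_exists_forall_reachable] at hC
  push Not at hC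
  obtain ⟨d, hd⟩ := hC ⟨c, hc⟩
  let S : Set C := {x | (G.induce C).Reachable ⟨c, hc⟩ x}
  refine ⟨Subtype.val '' S, Subtype.val '' Sᶜ, ?_,
    (Set.disjoint_image_iff Subtype.val_injective).mpr disjoint_compl_right,
    ⟨c, ⟨c, hc⟩, Reachable.refl _, rfl⟩, ⟨d, d, hd, rfl⟩, ?_⟩
  · rw [← Set.image_union, Set.union_compl_self, Set.image_univ, Subtype.range_coe]
  · rintro _ ⟨u, hu, rfl⟩ _ ⟨v, hv, rfl⟩ huv
    exact hv (Reachable.trans hu (Adj.reachable (G := G.induce C) huv))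

/-- A nonempty connected set `C` of vertices of a `K₄`-minor-free graph, attached to the rest
by `a` and `b` only, has a vertex `z` whose removal leaves two parts, attached by
`a` and `z` only and by `b` and `z` only. -/
theorem exists_series_vertex [Finite V] {G : SimpleGraph V} (hG : ¬ HasK4Minor G) {C : Set V}
    {a b : V} (hC : (G.induce C).Connected) (ha : a ∉ C) (hb : b ∉ C)
    (hbd : ∀ u ∈ C, ∀ v ∉ C, G.Adj u v → v = a ∨ v = b)
    (hlink : a ≠ b → (∃ u ∈ C, G.Adj a u) → (∃ u ∈ C, G.Adj b u) → G.AdjacentOutside C a b) :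
    ∃ z ∈ C, ∃ C₁ C₂ : Set V, C = insert z (C₁ ∪ C₂) ∧ z ∉ C₁ ∧ z ∉ C₂ ∧ Disjoint C₁ C₂ ∧
      (∀ u ∈ C₁, ∀ v ∉ C₁, G.Adj u v → v = a ∨ v = z) ∧
      (∀ u ∈ C₂, ∀ v ∉ C₂, G.Adj u v → v = b ∨ v = z) ∧
      ((∃ u ∈ C₁, G.Adj a u) → G.AdjacentOutside C₁ a z) ∧
      ((∃ u ∈ C₂, G.Adj b u) → G.AdjacentOutside C₂ b z) := by
  have hnbr : ∀ c, ∃ z ∈ C, ((∃ u ∈ C, G.Adj c u) → G.Adj c z) := by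
    intro c
    by_cases h : ∃ u ∈ C, G.Adj c u
    · obtain ⟨u, hu, hcu⟩ := h
      exact ⟨u, hu, fun _ => hcu⟩
    · obtain ⟨⟨w, hw⟩⟩ := hC.nonempty
      exact ⟨w, hw, fun h' => absurd h' h⟩
  by_cases h1 : a = b ∨ ¬ ∃ u ∈ C, G.Adj b u
  · obtain ⟨z, hz, haz⟩ := hnbr a
    refine ⟨z, hz, C \ {z}, ∅, ?_, by simp, by simp, by simp, ?_, by simp, ?_, by simp⟩
    · simp [Set.insert_eq_of_mem hz]
    · intro u hu v hv huv
      by_cases hvz : v = z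
      · exact Or.inr hvz
      · left
        rcases hbd u hu.1 v (fun h => hv ⟨h, hvz⟩) huv with h | rfl
        · exact h
        · rcases h1 with h1 | h1
          · exact h1.symm
          · exact absurd ⟨u, hu.1, huv.symm⟩ h1
    · rintro ⟨u, hu, hau⟩
      exact (haz ⟨u, hu.1, hau⟩).adjacentOutside (fun h => ha h.1) (by simp)
  by_cases h2 : ¬ ∃ u ∈ C, G.Adj a u
  · obtain ⟨z, hz, hbz⟩ := hnbr b
    refine ⟨z, hz, ∅, C \ {z}, ?_, by simp, by simp, by simp, by simp, ?_, by simp, ?_⟩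
    · simp [Set.insert_eq_of_mem hz]
    · intro u hu v hv huv
      by_cases hvz : v = z
      · exact Or.inr hvz
      · left
        rcases hbd u hu.1 v (fun h => hv ⟨h, hvz⟩) huv with rfl | h
        · exact absurd ⟨u, hu.1, huv.symm⟩ h2
        · exact h
    · rintro ⟨u, hu, hbu⟩
      exact (hbz ⟨u, hu.1, hbu⟩).adjacentOutside (fun h => hb h.1) (by simp)
  push Not at h1 h2
  obtain ⟨hab, u₂, hu₂, hbu₂⟩ := h1
  obtain ⟨u₁, hu₁, hau₁⟩ := h2
  have hout := hlink hab ⟨u₁, hu₁, hau₁⟩ ⟨u₂, hu₂, hbu₂⟩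
  have := hC.nonempty
  rcases hasCutVertex_or_hasTwoLinkage (G.induce C) {u | G.Adj a u} {u | G.Adj b u} with
    ⟨z, L, R, hcover, hLR, hA, hB, hcut⟩ | h
  swap
  · exact absurd (hout.hasK4Minor_of_hasTwoLinkage hC h) hG
  have hz : z ∈ L ∩ R := hLR ▸ rfl
  have hc : ∀ v, v ∈ L ∨ v ∈ R := fun v => (hcover.symm ▸ Set.mem_univ v : v ∈ L ∪ R)
  have hz' : ∀ v, v ∈ L → v ∈ R → v = z := fun v h1 h2 =>
    (hLR ▸ (⟨h1, h2⟩ : v ∈ L ∩ R) : v ∈ ({z} : Set C))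
  refine ⟨z, z.2, Subtype.val '' Rᶜ, Subtype.val '' Lᶜ, ?_, ?_, ?_, ?_, ?_, ?_, fun _ => ?_,
    fun _ => ?_⟩
  · ext v
    simp only [Set.mem_insert_iff, Set.mem_union]
    constructor
    · intro hv
      by_cases hvR : ⟨v, hv⟩ ∈ R
      · by_cases hvL : ⟨v, hv⟩ ∈ L
        · exact Or.inl (congrArg Subtype.val (hz' _ hvL hvR))
        · exact Or.inr (Or.inr ⟨⟨v, hv⟩, hvL, rfl⟩)
      · exact Or.inr (Or.inl ⟨⟨v, hv⟩, hvR, rfl⟩)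
    · rintro (rfl | ⟨x, -, rfl⟩ | ⟨x, -, rfl⟩) <;> exact Subtype.prop _
  · rintro ⟨x, hx, hxz⟩
    exact hx (Subtype.ext hxz ▸ hz.2)
  · rintro ⟨x, hx, hxz⟩
    exact hx (Subtype.ext hxz ▸ hz.1)
  · refine (Set.disjoint_image_iff Subtype.val_injective).mpr (Set.disjoint_left.mpr ?_)
    intro x hxR hxL
    exact (hc x).elim hxL hxR
  · rintro _ ⟨x, hx, rfl⟩ v hv hxv
    by_cases hvC : v ∈ C
    · right
      have hvR : ⟨v, hvC⟩ ∈ R := by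
        by_contra h
        exact hv ⟨_, h, rfl⟩
      have hvL : ⟨v, hvC⟩ ∈ L := by
        by_contra h
        exact hcut x ⟨v, hvC⟩ hx h hxv
      exact congrArg Subtype.val (hz' _ hvL hvR)
    · left
      rcases hbd x x.2 v hvC hxv with h | rfl
      · exact h
      · exact absurd (hB (a := x) hxv.symm) hx
  · rintro _ ⟨x, hx, rfl⟩ v hv hxv
    by_cases hvC : v ∈ C
    · right
      have hvL : ⟨v, hvC⟩ ∈ L := by
        by_contra h
        exact hv ⟨_, h, rfl⟩
      have hvR : ⟨v, hvC⟩ ∈ R := by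
        by_contra h
        exact hcut ⟨v, hvC⟩ x h hx hxv.symm
      exact congrArg Subtype.val (hz' _ hvL hvR)
    · left
      rcases hbd x x.2 v hvC hxv with rfl | h
      · exact absurd (hA (a := x) hxv.symm) hx
      · exact h
  · exact hout.of_cut hC hLR hcut ⟨⟨u₂, hu₂⟩, hB hbu₂, hbu₂⟩
  · exact hout.symm.of_cut hC (Set.inter_comm L R ▸ hLR)
      (fun u v hu hv huv => hcut v u hv hu huv.symm) ⟨⟨u₁, hu₁⟩, hA hau₁, hau₁⟩

/-- Let every pair of vertices of a `K₄`-minor-free graph carry a label, and let `R` be a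
labelled family of relations on the target graph `K`, such that every pair related by the label
of `a b` extends to every third vertex `z`. Then maps to `K` extend over sets attached by two
vertices. -/
theorem exists_extension_of_labelling [Finite V] {G : SimpleGraph V} (hG : ¬ HasK4Minor G)
    {ι β : Type*} {K : SimpleGraph β} (R : ι → β → β → Prop) (f : V → V → ι)
    (hadj : ∀ u v x y, G.Adj u v → R (f u v) x y → K.Adj x y)
    (hext : ∀ a b z x y, R (f a b) x y → ∃ t, R (f a z) x t ∧ R (f b z) y t) (C : Set V) :
    ∀ a b : V, a ∉ C → b ∉ C → (∀ u ∈ C, ∀ v ∉ C, G.Adj u v → v = a ∨ v = b) →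
      (a ≠ b → (∃ u ∈ C, G.Adj a u) → (∃ u ∈ C, G.Adj b u) → G.AdjacentOutside C a b) →
      ∀ φ₀ : V → β, R (f a b) (φ₀ a) (φ₀ b) →
        ∃ φ : V → β, (∀ v ∉ C, φ v = φ₀ v) ∧ ∀ u ∈ C, ∀ v, G.Adj u v → K.Adj (φ u) (φ v) := by
  induction C using WellFoundedLT.induction with
  | ind C ih =>
  intro a b ha hb hbd hlink φ₀ hφ₀
  rcases C.eq_empty_or_nonempty with rfl | hne
  · exact ⟨φ₀, by simp, by simp⟩
  by_cases hC : (G.induce C).Connected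
  · obtain ⟨z, hz, C₁, C₂, hCeq, hz₁, hz₂, hd, hbd₁, hbd₂, hlink₁, hlink₂⟩ :=
      exists_series_vertex hG hC ha hb hbd hlink
    obtain ⟨t, hat, hbt⟩ := hext a b z _ _ hφ₀
    have hsub₁ : C₁ ⊆ C := by rw [hCeq]; exact fun v hv => Or.inr (Or.inl hv)
    have hsub₂ : C₂ ⊆ C := by rw [hCeq]; exact fun v hv => Or.inr (Or.inr hv)
    have hlt₁ : C₁ < C := lt_of_le_of_ne hsub₁ fun h => hz₁ (h ▸ hz)
    have hlt₂ : C₂ < C := lt_of_le_of_ne hsub₂ fun h => hz₂ (h ▸ hz)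
    have haz : a ≠ z := fun h => ha (h ▸ hz)
    have hbz : b ≠ z := fun h => hb (h ▸ hz)
    classical
    obtain ⟨φ₁, hφ₁, hhom₁⟩ := ih C₁ hlt₁ a z (fun h => ha (hsub₁ h)) hz₁ hbd₁
      (fun _ h _ => hlink₁ h) (Function.update φ₀ z t)
      (by simpa [Function.update_of_ne haz] using hat)
    have hφ₁a : φ₁ a = φ₀ a := by
      rw [hφ₁ a fun h => ha (hsub₁ h), Function.update_of_ne haz]
    have hφ₁b : φ₁ b = φ₀ b := by
      rw [hφ₁ b fun h => hb (hsub₁ h), Function.update_of_ne hbz]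
    have hφ₁z : φ₁ z = t := by rw [hφ₁ z hz₁, Function.update_self]
    obtain ⟨φ₂, hφ₂, hhom₂⟩ := ih C₂ hlt₂ b z (fun h => hb (hsub₂ h)) hz₂ hbd₂
      (fun _ h _ => hlink₂ h) φ₁ (by rwa [hφ₁b, hφ₁z])
    have hφ₂a : φ₂ a = φ₀ a := by rw [hφ₂ a fun h => ha (hsub₂ h), hφ₁a]
    have hφ₂b : φ₂ b = φ₀ b := by rw [hφ₂ b fun h => hb (hsub₂ h), hφ₁b]
    have hφ₂z : φ₂ z = t := by rw [hφ₂ z hz₂, hφ₁z]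
    have hhom₁' : ∀ u ∈ C₁, ∀ v, G.Adj u v → K.Adj (φ₂ u) (φ₂ v) := by
      intro u hu v huv
      have hv : v ∉ C₂ := by
        intro hv
        by_cases hv₁ : v ∈ C₁
        · exact Set.disjoint_left.mp hd hv₁ hv
        · rcases hbd₁ u hu v hv₁ huv with rfl | rfl
          · exact ha (hsub₂ hv)
          · exact hz₂ hv
      rw [hφ₂ u (Set.disjoint_left.mp hd hu), hφ₂ v hv]
      exact hhom₁ u hu v huv
    refine ⟨φ₂, ?_, ?_⟩
    · intro v hv
      rw [hφ₂ v fun h => hv (hsub₂ h), hφ₁ v fun h => hv (hsub₁ h),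
        Function.update_of_ne (ne_of_mem_of_not_mem hz hv).symm]
    · intro u hu v huv
      rw [hCeq] at hu
      rcases hu with rfl | hu | hu
      · by_cases hv : v ∈ C
        · rw [hCeq] at hv
          rcases hv with rfl | hv | hv
          · exact absurd huv (G.loopless.irrefl _)
          · exact (hhom₁' v hv u huv.symm).symm
          · exact (hhom₂ v hv u huv.symm).symm
        · rcases hbd u hz v hv huv with rfl | rfl
          · rw [hφ₂a, hφ₂z]
            exact (hadj v u _ _ huv.symm hat).symm
          · rw [hφ₂b, hφ₂z]
            exact (hadj v u _ _ huv.symm hbt).symm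
      · exact hhom₁' u hu v huv
      · exact hhom₂ u hu v huv
  · obtain ⟨C₁, C₂, rfl, hd, ⟨c₁, hc₁⟩, ⟨c₂, hc₂⟩, hno⟩ := exists_split_of_not_connected hne hC
    have hlt₁ : C₁ < C₁ ∪ C₂ := lt_of_le_of_ne Set.subset_union_left fun h =>
      Set.disjoint_right.mp hd hc₂ (h ▸ Or.inr hc₂)
    have hlt₂ : C₂ < C₁ ∪ C₂ := lt_of_le_of_ne Set.subset_union_right fun h =>
      Set.disjoint_left.mp hd hc₁ (h ▸ Or.inl hc₁)
    have hlink' : ∀ D, D ⊆ C₁ ∪ C₂ → a ≠ b → (∃ u ∈ D, G.Adj a u) → (∃ u ∈ D, G.Adj b u) →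
        G.AdjacentOutside D a b := fun D hD hab ⟨u, hu, hau⟩ ⟨v, hv, hbv⟩ =>
      (hlink hab ⟨u, hD hu, hau⟩ ⟨v, hD hv, hbv⟩).mono hD
    obtain ⟨φ₁, hφ₁, hhom₁⟩ := ih C₁ hlt₁ a b (fun h => ha (Or.inl h)) (fun h => hb (Or.inl h))
      (fun u hu v hv huv => hbd u (Or.inl hu) v
        (fun h => h.elim hv fun h => hno u hu v h huv) huv)
      (hlink' C₁ Set.subset_union_left) φ₀ hφ₀
    obtain ⟨φ₂, hφ₂, hhom₂⟩ := ih C₂ hlt₂ a b (fun h => ha (Or.inr h)) (fun h => hb (Or.inr h))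
      (fun u hu v hv huv => hbd u (Or.inr hu) v
        (fun h => h.elim (fun h => hno v h u hu huv.symm) hv) huv)
      (hlink' C₂ Set.subset_union_right) φ₁
      (by rwa [hφ₁ a fun h => ha (Or.inl h), hφ₁ b fun h => hb (Or.inl h)])
    refine ⟨φ₂, ?_, ?_⟩
    · intro v hv
      rw [hφ₂ v fun h => hv (Or.inr h), hφ₁ v fun h => hv (Or.inl h)]
    · rintro u (hu | hu) v huv
      · rw [hφ₂ u (Set.disjoint_left.mp hd hu), hφ₂ v fun h => hno u hu v h huv]
        exact hhom₁ u hu v huv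
      · exact hhom₂ u hu v huv

/-- A `K₄`-minor-free graph with a labelling of its pairs of vertices as in
`exists_extension_of_labelling` maps to the target graph. -/
theorem nonempty_hom_of_labelling [Finite V] {G : SimpleGraph V} (hG : ¬ HasK4Minor G)
    {ι β : Type*} {K : SimpleGraph β} (R : ι → β → β → Prop) (f : V → V → ι)
    (hadj : ∀ u v x y, G.Adj u v → R (f u v) x y → K.Adj x y)
    (hext : ∀ a b z x y, R (f a b) x y → ∃ t, R (f a z) x t ∧ R (f b z) y t)
    (hdiag : ∀ a, ∃ x, R (f a a) x x) : Nonempty (G →g K) := by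
  rcases isEmpty_or_nonempty V with _ | ⟨⟨a⟩⟩
  · exact ⟨⟨isEmptyElim, fun {u} => isEmptyElim u⟩⟩
  obtain ⟨x, hx⟩ := hdiag a
  obtain ⟨φ, -, hφ⟩ := exists_extension_of_labelling hG R f hadj hext {a}ᶜ a a (by simp) (by simp)
    (fun _ _ v hv _ => Or.inl (by simpa using hv)) (fun h => absurd rfl h) (fun _ => x) hx
  refine ⟨⟨φ, fun {u v} huv => ?_⟩⟩
  by_cases hu : u = a
  · exact (hφ v (fun hv => huv.ne (hu.trans hv.symm)) u huv.symm).symm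
  · exact hφ u hu v huv

end Extension

section OddGirth

/-- Admissible triples: three numbers at most `3` that satisfy the triangle inequalities and
have sum at most `7`. -/
def IsGoodTriple (p q r : ℕ) : Prop :=
  p ≤ 3 ∧ q ≤ 3 ∧ r ≤ 3 ∧ p ≤ q + r ∧ q ≤ p + r ∧ r ≤ p + q ∧ p + q + r ≤ 7

instance (p q r : ℕ) : Decidable (IsGoodTriple p q r) :=
  inferInstanceAs (Decidable (_ ∧ _))

open Classical in
/-- The label of a pair of vertices: `0` for equal, `3` for adjacent vertices, `1` for vertices
with a common neighbour, and `2` otherwise. -/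
noncomputable def pairLabel (G : SimpleGraph V) (u v : V) : ℕ :=
  if u = v then 0 else if G.Adj u v then 3 else if ∃ w, G.Adj u w ∧ G.Adj w v then 1 else 2

theorem not_adj_triangle {G : SimpleGraph V} (hG : oddGirthAtLeast G 7) {a b c : V}
    (hab : G.Adj a b) (hbc : G.Adj b c) : ¬ G.Adj c a := by
  intro hca
  have h := hG a (.cons hab (.cons hbc (.cons hca .nil))) (by
    simp [Walk.isCycle_def, Walk.isTrail_def, hab.ne, hab.ne', hbc.ne, hca.ne, hca.ne'])
    (by simp; decide)
  simp at h

theorem not_adj_pentagon {G : SimpleGraph V} (hG : oddGirthAtLeast G 7) {a b c d e : V}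
    (hab : G.Adj a b) (hbc : G.Adj b c) (hcd : G.Adj c d) (hde : G.Adj d e) : ¬ G.Adj e a := by
  intro hea
  have hac : a ≠ c := by rintro rfl; exact not_adj_triangle hG hcd hde hea
  have hbd : b ≠ d := by rintro rfl; exact not_adj_triangle hG hde hea hab
  have hce : c ≠ e := by rintro rfl; exact not_adj_triangle hG hea hab hbc
  have hda : d ≠ a := by rintro rfl; exact not_adj_triangle hG hab hbc hcd
  have heb : e ≠ b := by rintro rfl; exact not_adj_triangle hG hbc hcd hde
  have h := hG a (.cons hab (.cons hbc (.cons hcd (.cons hde (.cons hea .nil))))) (by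
    simp [Walk.isCycle_def, Walk.isTrail_def, hab.ne, hab.ne', hbc.ne, hcd.ne, hde.ne, hea.ne,
      hea.ne', hac, hac.symm, hbd, hce, hda, hda.symm, heb.symm])
    (by simp; decide)
  simp at h

theorem pairLabel_le_three (G : SimpleGraph V) (u v : V) : G.pairLabel u v ≤ 3 := by
  unfold pairLabel
  split_ifs <;> decide

theorem pairLabel_comm (G : SimpleGraph V) (u v : V) : G.pairLabel u v = G.pairLabel v u := by
  have h : (∃ w, G.Adj u w ∧ G.Adj w v) ↔ ∃ w, G.Adj v w ∧ G.Adj w u :=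
    exists_congr fun w => ⟨fun h => ⟨h.2.symm, h.1.symm⟩, fun h => ⟨h.2.symm, h.1.symm⟩⟩
  have h' : u = v ↔ v = u := eq_comm
  classical
  unfold pairLabel
  convert if_congr h' (rfl : 0 = 0) (if_congr (G.adj_comm u v) rfl (if_congr h rfl rfl))

@[simp]
theorem pairLabel_self (G : SimpleGraph V) (v : V) : G.pairLabel v v = 0 := by
  simp [pairLabel]

theorem eq_of_pairLabel_eq_zero {G : SimpleGraph V} {u v : V} (h : G.pairLabel u v = 0) :
    u = v := by
  by_contra huv
  simp only [pairLabel, huv, if_false] at h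
  split_ifs at h

theorem pairLabel_eq_three_iff {G : SimpleGraph V} {u v : V} :
    G.pairLabel u v = 3 ↔ G.Adj u v := by
  unfold pairLabel
  split_ifs with h1 h2 h3
  · subst h1; simp
  all_goals simp [h2]

theorem exists_common_of_pairLabel_eq_one {G : SimpleGraph V} {u v : V}
    (h : G.pairLabel u v = 1) : ∃ w, G.Adj u w ∧ G.Adj w v := by
  by_contra hw
  simp only [pairLabel, hw, if_false] at h
  split_ifs at h <;> simp at h

theorem pairLabel_le_one_of_adj {G : SimpleGraph V} (hG : oddGirthAtLeast G 7) {u v w : V}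
    (huw : G.Adj u w) (hwv : G.Adj w v) : G.pairLabel u v ≤ 1 := by
  unfold pairLabel
  split_ifs with h1 h2 h3
  · exact zero_le_one
  · exact absurd h2.symm (not_adj_triangle hG huw hwv)
  · exact le_rfl
  · exact absurd ⟨w, huw, hwv⟩ h3

theorem isGoodTriple_pairLabel {G : SimpleGraph V} (hG : oddGirthAtLeast G 7) (a b z : V) :
    IsGoodTriple (G.pairLabel a b) (G.pairLabel a z) (G.pairLabel b z) := by
  have hzero : ∀ u v w, G.pairLabel u v = 0 → G.pairLabel u w = G.pairLabel v w :=
    fun u v w h => by rw [eq_of_pairLabel_eq_zero h]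
  have hthree : ∀ u v w, G.pairLabel u v = 3 → G.pairLabel v w = 3 → G.pairLabel u w ≤ 1 :=
    fun u v w h h' =>
      pairLabel_le_one_of_adj hG (pairLabel_eq_three_iff.mp h) (pairLabel_eq_three_iff.mp h')
  have hone : ∀ u v w, G.pairLabel u v = 1 → G.pairLabel v w = 1 → G.pairLabel u w ≠ 3 := by
    intro u v w h h' h3
    obtain ⟨x, hux, hxv⟩ := exists_common_of_pairLabel_eq_one h
    obtain ⟨y, hvy, hyw⟩ := exists_common_of_pairLabel_eq_one h'
    exact not_adj_pentagon hG hux hxv hvy hyw (pairLabel_eq_three_iff.mp h3).symm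
  have := G.pairLabel_le_three a b
  have := G.pairLabel_le_three a z
  have := G.pairLabel_le_three b z
  have := hzero a b z
  have := hzero a z b
  have := hzero b z a
  have := hthree a b z
  have := hthree a z b
  have := hthree b a z
  have := hone a b z
  have := hone a z b
  have := hone b a z
  simp only [G.pairLabel_comm b a, G.pairLabel_comm z a, G.pairLabel_comm z b] at *
  unfold IsGoodTriple
  omega

end OddGirth

end SimpleGraph

/-- A partial labelling of the pairs of vertices of `X₁₅`: `0` for equal, `3` for adjacent
vertices, `1` for vertices with a common neighbour, `2` for the other pairs except those of two
vertices `xᵢ`, which get `4`. -/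
def X15Label : ZMod 10 ⊕ Fin 5 → ZMod 10 ⊕ Fin 5 → ℕ
  | .inl a, .inl b => (![0, 3, 1, 2, 2, 1, 2, 2, 1, 3] : Fin 10 → ℕ) (b - a)
  | .inl a, .inr i => (![3, 1, 2, 2, 1] : Fin 5 → ℕ) (Fin.ofNat 5 a.val - i)
  | .inr i, .inl a => (![3, 1, 2, 2, 1] : Fin 5 → ℕ) (Fin.ofNat 5 a.val - i)
  | .inr i, .inr j => if i = j then 0 else 4

theorem X15_adj_of_label {x y : ZMod 10 ⊕ Fin 5} (h : X15Label x y = 3) : X15.Adj x y := by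
  have key : ∀ a : ZMod 10, ∀ i : Fin 5, X15Label (.inl a) (.inr i) = 3 →
      a = ((i : ℕ) : ZMod 10) ∨ a = ((i : ℕ) : ZMod 10) + 5 := by decide
  rcases x with a | i <;> rcases y with b | j
  · have key' : ∀ a b : ZMod 10, X15Label (.inl a) (.inl b) = 3 →
        a ≠ b ∧ (b = a + 1 ∨ a = b + 1) := by decide
    exact ⟨fun h' => (key' a b h).1 (Sum.inl.inj h'), (key' a b h).2⟩
  · exact ⟨Sum.inl_ne_inr, Or.inr (key a j h)⟩
  · exact ⟨Sum.inr_ne_inl, Or.inl (key b i h)⟩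
  · have key' : ∀ i j : Fin 5, X15Label (.inr i) (.inr j) ≠ 3 := by decide
    exact absurd h (key' i j)

theorem X15Label_extend : ∀ x y : ZMod 10 ⊕ Fin 5, ∀ q < 4, ∀ r < 4,
    SimpleGraph.IsGoodTriple (X15Label x y) q r → ∃ t, X15Label x t = q ∧ X15Label y t = r := by
  decide

/-- Every finite `K₄`-minor-free graph of odd-girth at least `7` admits a
homomorphism to `X₁₅`. -/
theorem SP7_to_X15 {V : Type*} [Fintype V] (G : SimpleGraph V)
    (h1 : ¬ HasK4Minor G) (h2 : oddGirthAtLeast G 7) :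
    Nonempty (G →g X15) := by
  refine nonempty_hom_of_labelling h1 (fun p x y => X15Label x y = p) G.pairLabel
    (fun u v x y huv h => X15_adj_of_label (h.trans (pairLabel_eq_three_iff.mpr huv)))
    (fun a b z x y h => X15Label_extend x y _ (Nat.lt_succ_of_le (G.pairLabel_le_three a z)) _
      (Nat.lt_succ_of_le (G.pairLabel_le_three b z)) ?_)
    (fun a => ⟨.inl 0, by rw [pairLabel_self]; rfl⟩)
  rw [h]
  exact isGoodTriple_pairLabel h2 a b z
end
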